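/- arXiv:1309.4299 — 2 statements merged into one kernel-verified Lean document; each statement's English description precedes it below -/
import Mathlib

section
/- Let u be a smooth solution of (−Δ)^{3/2}u = 2e^{3u} with finite volume. Then v is twice continuously differentiable with −Δv(x) = (1/π²)∫_{ℝ³} e^{3u(y)}/|x−y|² dy for every x ∈ ℝ³, Δv ∈ L_{1/2}(ℝ³), and for every Schwartz function φ : ℝ³ → ℝ one has ∫_{ℝ³} (−Δv)(x)·((−Δ)^{1/2}φ)(x) dx = 2∫_{ℝ³} e^{3u(x)}φ(x) dx = ∫_{ℝ³} (−Δu)(x)·((−Δ)^{1/2}φ)(x) dx; that is, (−Δ)^{3/2}v = (−Δ)^{3/2}u = 2e^{3u} in the distributional sense. -/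
open MeasureTheory Real Filter

noncomputable section

abbrev E3 := EuclideanSpace ℝ (Fin 3)

/-- The Laplacian of `f : ℝ³ → ℝ` as the sum of second partial derivatives. -/
def lap (f : E3 → ℝ) (x : E3) : ℝ :=
  ∑ i, fderiv ℝ (fun y => fderiv ℝ f y (EuclideanSpace.single i 1)) x (EuclideanSpace.single i 1)

/-- The half Laplacian `(-Δ)^{1/2} φ` of a Schwartz function on ℝ³, defined as a
principal value: `(1/π²) lim_{ε→0⁺} ∫_{|x−y|>ε} (φ(x)−φ(y))/|x−y|⁴ dy`. -/
def halfLap (φ : SchwartzMap E3 ℝ) (x : E3) : ℝ :=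
  limUnder (nhdsWithin (0:ℝ) (Set.Ioi 0)) fun ε =>
    (1 / π ^ 2) * ∫ y in {y : E3 | ε < ‖x - y‖}, (φ x - φ y) / ‖x - y‖ ^ 4

/-- `w ∈ L_{1/2}(ℝ³)`. -/
def MemL12 (w : E3 → ℝ) : Prop :=
  LocallyIntegrable w volume ∧ Integrable (fun x => |w x| / (1 + ‖x‖ ^ 4)) volume

/-- `u` is a smooth solution of `(-Δ)^{3/2} u = 2 e^{3u}` in ℝ³ with finite volume. -/
def IsSolution (u : E3 → ℝ) : Prop :=
  ContDiff ℝ (⊤ : ℕ∞) u ∧ MemL12 (lap u) ∧ Integrable (fun x => exp (3 * u x)) volume ∧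
    ∀ φ : SchwartzMap E3 ℝ,
      ∫ x, (-(lap u x)) * halfLap φ x = 2 * ∫ x, exp (3 * u x) * φ x

/-- `u` is a spherical solution. -/
def IsSpherical (u : E3 → ℝ) : Prop :=
  ∃ lam : ℝ, 0 < lam ∧ ∃ x₀ : E3, ∀ x, u x = log (2 * lam / (1 + lam ^ 2 * ‖x - x₀‖ ^ 2))

/-- `α = (1/π²) ∫ e^{3u}`. -/
def solAlpha (u : E3 → ℝ) : ℝ := (1 / π ^ 2) * ∫ y, exp (3 * u y)

/-- `v(x) = (1/π²) ∫ log(|y|/|x−y|) e^{3u(y)} dy`. -/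
def solV (u : E3 → ℝ) (x : E3) : ℝ :=
  (1 / π ^ 2) * ∫ y, log (‖y‖ / ‖x - y‖) * exp (3 * u y)

end

theorem finrank_E3 : Module.finrank ℝ E3 = 3 := by simp

theorem integrableOn_ball_inv_norm_sq :
    IntegrableOn (fun z : E3 => 1 / ‖z‖ ^ 2) (Metric.ball 0 1) := by
  have h := (integrableOn_fun_norm_addHaar (E := E3) volume (f := fun r : ℝ => 1 / r ^ 2)
    (r := 1)).2
  apply h
  rw [finrank_E3]
  have : IntegrableOn (fun _ : ℝ => (1 : ℝ)) (Set.Ioo 0 1) := by simp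
  refine this.congr_fun (fun y hy => ?_) measurableSet_Ioo
  have : y ≠ 0 := hy.1.ne'
  simp [this]

theorem integrable_inv_one_add_norm_pow_four :
    Integrable (fun x : E3 => 1 / (1 + ‖x‖) ^ 4) := by
  have h := integrable_one_add_norm (E := E3) (μ := volume) (r := 4)
    (by rw [finrank_E3]; norm_num)
  refine h.congr (ae_of_all _ fun x => ?_)
  have : 0 < 1 + ‖x‖ := by positivity
  simp only [rpow_neg this.le]
  norm_cast
  simp

theorem integrable_indicator_ball_inv_norm_sq :
    Integrable (fun z : E3 => (Metric.ball (0 : E3) 1).indicator (fun z => 1 / ‖z‖ ^ 2) z) :=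
  (integrable_indicator_iff Metric.isOpen_ball.measurableSet).2 integrableOn_ball_inv_norm_sq

theorem min_div_norm_pow_four_le (z : E3) :
    min 1 (‖z‖ ^ 2) / ‖z‖ ^ 4 ≤
      (Metric.ball (0 : E3) 1).indicator (fun z => 1 / ‖z‖ ^ 2) z + 16 * (1 / (1 + ‖z‖) ^ 4) := by
  by_cases hz : ‖z‖ < 1
  · rw [Set.indicator_of_mem (by simpa using hz)]
    have h1 : min 1 (‖z‖ ^ 2) / ‖z‖ ^ 4 ≤ ‖z‖ ^ 2 / ‖z‖ ^ 4 := by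
      gcongr; exact min_le_right _ _
    have h2 : ‖z‖ ^ 2 / ‖z‖ ^ 4 = 1 / ‖z‖ ^ 2 := by
      rcases eq_or_ne ‖z‖ 0 with h | h
      · simp [h]
      · field_simp
    have : 0 ≤ 16 * (1 / (1 + ‖z‖) ^ 4) := by positivity
    linarith
  · rw [Set.indicator_of_notMem (by simpa using hz), zero_add]
    push Not at hz
    have h1 : min 1 (‖z‖ ^ 2) / ‖z‖ ^ 4 ≤ 1 / ‖z‖ ^ 4 := by
      gcongr; exact min_le_left _ _
    have h2 : (1 + ‖z‖) ^ 4 ≤ 16 * ‖z‖ ^ 4 := by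
      calc (1 + ‖z‖) ^ 4 ≤ (2 * ‖z‖) ^ 4 := by gcongr; linarith
        _ = _ := by ring
    refine h1.trans ?_
    rw [mul_one_div, div_le_div_iff₀ (by positivity) (by positivity)]
    linarith

theorem integrable_min_div_norm_pow_four :
    Integrable (fun z : E3 => min 1 (‖z‖ ^ 2) / ‖z‖ ^ 4) := by
  refine (integrable_indicator_ball_inv_norm_sq.add
    (integrable_inv_one_add_norm_pow_four.const_mul 16)).mono' ?_ (ae_of_all _ fun z => ?_)
  · exact Measurable.aestronglyMeasurable (by fun_prop)
  · rw [norm_of_nonneg (by positivity)]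
    exact min_div_norm_pow_four_le z

section Potential

variable {F : Type*} [NormedAddCommGroup F]

theorem stronglyMeasurable_of_continuousOn_compl_zero [SecondCountableTopology F] {k : E3 → F}
    (hk : ContinuousOn k {0}ᶜ) : StronglyMeasurable k := by
  borelize F
  exact (measurable_of_continuousOn_compl_singleton 0 hk).stronglyMeasurable

theorem norm_mul_min_le {k : E3 → F} {C : ℝ} (hC : 0 ≤ C)
    (hb : ∀ z, ‖k z‖ ≤ C * (1 / ‖z‖ ^ 2 + 1)) (z : E3) : min 1 (‖z‖ ^ 2) * ‖k z‖ ≤ 2 * C := by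
  have h0 : 0 ≤ min 1 (‖z‖ ^ 2) := by positivity
  calc min 1 (‖z‖ ^ 2) * ‖k z‖ ≤ min 1 (‖z‖ ^ 2) * (C * (1 / ‖z‖ ^ 2 + 1)) := by
        gcongr; exact hb z
    _ = C * (min 1 (‖z‖ ^ 2) / ‖z‖ ^ 2 + min 1 (‖z‖ ^ 2)) := by ring
    _ ≤ C * (1 + 1) := by
        gcongr
        · exact div_le_one_of_le₀ (min_le_right _ _) (by positivity)
        · exact min_le_left _ _
    _ = 2 * C := by ring

variable [NormedSpace ℝ F]

theorem norm_one_sub_min_mul_le {k : E3 → F} {C : ℝ} (hC : 0 ≤ C)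
    (hb : ∀ z, ‖k z‖ ≤ C * (1 / ‖z‖ ^ 2 + 1)) (z : E3) (hz : z ≠ 0) :
    ‖(1 - min 1 (‖z‖ ^ 2)) • k z‖ ≤
      (2 * C) * (Metric.ball (0 : E3) 1).indicator (fun z => 1 / ‖z‖ ^ 2) z := by
  by_cases h : ‖z‖ < 1
  · rw [Set.indicator_of_mem (by simpa using h), norm_smul]
    have hp : 0 < ‖z‖ := norm_pos_iff.2 hz
    have h1 : ‖1 - min 1 (‖z‖ ^ 2)‖ ≤ 1 := by
      have : 0 ≤ min 1 (‖z‖ ^ 2) := by positivity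
      have := min_le_left 1 (‖z‖ ^ 2)
      rw [norm_eq_abs, abs_le]; constructor <;> linarith
    have h2 : 1 ≤ 1 / ‖z‖ ^ 2 := by
      rw [le_div_iff₀ (by positivity)]; nlinarith
    calc _ ≤ 1 * (C * (1 / ‖z‖ ^ 2 + 1)) := by gcongr; exact hb z
      _ ≤ 1 * (C * (1 / ‖z‖ ^ 2 + 1 / ‖z‖ ^ 2)) := by gcongr
      _ = _ := by ring
  · rw [Set.indicator_of_notMem (by simpa using h)]
    push Not at h
    have : min 1 (‖z‖ ^ 2) = 1 := min_eq_left (by nlinarith)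
    simp [this]

variable {f : E3 → ℝ} {k : E3 → F} {C : ℝ}

theorem integrable_far_part [SecondCountableTopology F] (hf : Continuous f) (hfi : Integrable f)
    (hk : ContinuousOn k {0}ᶜ) (hC : 0 ≤ C) (hb : ∀ z, ‖k z‖ ≤ C * (1 / ‖z‖ ^ 2 + 1)) (x : E3) :
    Integrable (fun y => f y • (min 1 (‖x - y‖ ^ 2) • k (x - y))) := by
  have hm := stronglyMeasurable_of_continuousOn_compl_zero hk
  refine (hfi.norm.mul_const (2 * C)).mono' ?_ (ae_of_all _ fun y => ?_)
  · refine hf.aestronglyMeasurable.smul (AEStronglyMeasurable.smul ?_ ?_)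
    · exact Continuous.aestronglyMeasurable (by fun_prop)
    · exact (hm.comp_measurable (by fun_prop)).aestronglyMeasurable
  · rw [norm_smul, norm_smul, norm_of_nonneg (by positivity : 0 ≤ min 1 (‖x - y‖ ^ 2))]
    exact mul_le_mul_of_nonneg_left (norm_mul_min_le hC hb _) (norm_nonneg _)

theorem exists_near_bound (hf : Continuous f) (hC : 0 ≤ C) (hb : ∀ z, ‖k z‖ ≤ C * (1 / ‖z‖ ^ 2 + 1))
    (x₀ : E3) : ∃ M : ℝ, ∀ x ∈ Metric.ball x₀ 1, ∀ z : E3, z ≠ 0 →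
    ‖f (x - z) • ((1 - min 1 (‖z‖ ^ 2)) • k z)‖ ≤
      M * ((2 * C) * (Metric.ball (0 : E3) 1).indicator (fun z => 1 / ‖z‖ ^ 2) z) := by
  obtain ⟨M, hM⟩ := (isCompact_closedBall x₀ 2).exists_bound_of_continuousOn hf.continuousOn
  refine ⟨M, fun x hx z hz => ?_⟩
  have h2 := norm_one_sub_min_mul_le hC hb z hz
  by_cases h : ‖z‖ < 1
  · rw [norm_smul]
    have hM' : ‖f (x - z)‖ ≤ M := by
      apply hM
      rw [mem_closedBall_iff_norm]
      have := mem_ball_iff_norm.1 hx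
      calc ‖x - z - x₀‖ = ‖(x - x₀) - z‖ := by congr 1; abel
        _ ≤ ‖x - x₀‖ + ‖z‖ := norm_sub_le _ _
        _ ≤ 2 := by linarith
    exact mul_le_mul hM' h2 (norm_nonneg _) ((norm_nonneg _).trans hM')
  · rw [Set.indicator_of_notMem (by simpa using h)] at h2 ⊢
    rw [norm_smul]
    have : ‖(1 - min 1 (‖z‖ ^ 2)) • k z‖ = 0 :=
      le_antisymm (by simpa using h2) (norm_nonneg _)
    rw [this]; simp

theorem aestronglyMeasurable_near_part [SecondCountableTopology F] (hf : Continuous f)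
    (hk : ContinuousOn k {0}ᶜ) (x : E3) :
    AEStronglyMeasurable (fun z => f (x - z) • ((1 - min 1 (‖z‖ ^ 2)) • k z)) := by
  have hm := stronglyMeasurable_of_continuousOn_compl_zero hk
  refine AEStronglyMeasurable.smul ?_ (AEStronglyMeasurable.smul ?_ ?_)
  · exact Continuous.aestronglyMeasurable (by fun_prop)
  · exact Continuous.aestronglyMeasurable (by fun_prop)
  · exact hm.aestronglyMeasurable

theorem integrable_near_part [SecondCountableTopology F] (hf : Continuous f)
    (hk : ContinuousOn k {0}ᶜ) (hC : 0 ≤ C)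
    (hb : ∀ z, ‖k z‖ ≤ C * (1 / ‖z‖ ^ 2 + 1)) (x : E3) :
    Integrable (fun z => f (x - z) • ((1 - min 1 (‖z‖ ^ 2)) • k z)) := by
  obtain ⟨M, hM⟩ := exists_near_bound hf hC hb x
  refine ((integrable_indicator_ball_inv_norm_sq.const_mul (2 * C)).const_mul M).mono'
    (aestronglyMeasurable_near_part hf hk x) ?_
  filter_upwards [Measure.ae_ne volume (0 : E3)] with z hz
  exact hM x (by simp) z hz

theorem potential_eq_near_add_far (f : E3 → ℝ) (k : E3 → F) (x y : E3) : f y • k (x - y) =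
    f (x - (x - y)) • ((1 - min 1 (‖x - y‖ ^ 2)) • k (x - y)) +
      f y • (min 1 (‖x - y‖ ^ 2) • k (x - y)) := by
  rw [sub_sub_cancel, ← smul_add, ← add_smul]; simp

theorem integrable_potential [SecondCountableTopology F] (hf : Continuous f) (hfi : Integrable f)
    (hk : ContinuousOn k {0}ᶜ) (hC : 0 ≤ C) (hb : ∀ z, ‖k z‖ ≤ C * (1 / ‖z‖ ^ 2 + 1)) (x : E3) :
    Integrable (fun y => f y • k (x - y)) := by
  simp_rw [fun y => potential_eq_near_add_far f k x y]
  exact ((integrable_near_part hf hk hC hb x).comp_sub_left x).add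
    (integrable_far_part hf hfi hk hC hb x)

theorem continuous_potential [SecondCountableTopology F] (hf : Continuous f) (hfi : Integrable f)
    (hk : ContinuousOn k {0}ᶜ) (hC : 0 ≤ C) (hb : ∀ z, ‖k z‖ ≤ C * (1 / ‖z‖ ^ 2 + 1)) :
    Continuous (fun x => ∫ y, f y • k (x - y)) := by
  have key : (fun x => ∫ y, f y • k (x - y)) = fun x =>
      (∫ z, f (x - z) • ((1 - min 1 (‖z‖ ^ 2)) • k z)) +
        ∫ y, f y • (min 1 (‖x - y‖ ^ 2) • k (x - y)) := by
    ext x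
    rw [← integral_sub_left_eq_self (fun z => f (x - z) • ((1 - min 1 (‖z‖ ^ 2)) • k z)) volume x,
      ← integral_add ((integrable_near_part hf hk hC hb x).comp_sub_left x)
        (integrable_far_part hf hfi hk hC hb x)]
    simp_rw [← potential_eq_near_add_far f k]
  rw [key]
  refine Continuous.add ?_ ?_ <;> rw [continuous_iff_continuousAt] <;> intro x₀
  · obtain ⟨M, hM⟩ := exists_near_bound hf hC hb x₀
    refine continuousAt_of_dominated (bound := fun z =>
      M * ((2 * C) * (Metric.ball (0 : E3) 1).indicator (fun z => 1 / ‖z‖ ^ 2) z)) ?_ ?_ ?_ ?_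
    · exact Eventually.of_forall fun x => aestronglyMeasurable_near_part hf hk x
    · filter_upwards [Metric.ball_mem_nhds x₀ one_pos] with x hx
      filter_upwards [Measure.ae_ne volume (0 : E3)] with z hz
      exact hM x hx z hz
    · exact (integrable_indicator_ball_inv_norm_sq.const_mul (2 * C)).const_mul M
    · exact ae_of_all _ fun z => by fun_prop
  · refine continuousAt_of_dominated (bound := fun y => ‖f y‖ * (2 * C)) ?_ ?_ ?_ ?_
    · exact Eventually.of_forall fun x => (integrable_far_part hf hfi hk hC hb x).1
    · refine Eventually.of_forall fun x => ae_of_all _ fun y => ?_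
      rw [norm_smul, norm_smul, norm_of_nonneg (by positivity : 0 ≤ min 1 (‖x - y‖ ^ 2))]
      exact mul_le_mul_of_nonneg_left (norm_mul_min_le hC hb _) (norm_nonneg _)
    · exact hfi.norm.mul_const (2 * C)
    · filter_upwards [Measure.ae_ne volume x₀] with y hy
      have hne : x₀ - y ≠ 0 := sub_ne_zero.2 hy.symm
      have hkc : ContinuousAt k (x₀ - y) := hk.continuousAt (isOpen_compl_singleton.mem_nhds hne)
      have hkc' : ContinuousAt (fun x => k (x - y)) x₀ :=
        ContinuousAt.comp (f := fun x => x - y) (g := k) hkc (by fun_prop)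
      have : ContinuousAt (fun x => min 1 (‖x - y‖ ^ 2)) x₀ := by fun_prop
      exact continuousAt_const.smul (this.smul hkc')

end Potential

theorem ae_forall_add_smul_ne (x h : E3) : ∀ᵐ y : E3, ∀ s : ℝ, x + s • h - y ≠ 0 := by
  set S : AffineSubspace ℝ E3 := AffineSubspace.mk' x (Submodule.span ℝ {h}) with hS
  have hne : S ≠ ⊤ := by
    intro htop
    have h1 : S.direction = ⊤ := by rw [htop, AffineSubspace.direction_top]
    rw [hS, AffineSubspace.direction_mk'] at h1
    have h2 := finrank_span_le_card (R := ℝ) ({h} : Set E3)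
    rw [h1, finrank_top, finrank_E3] at h2
    simp at h2
  have h0 := Measure.addHaar_affineSubspace (volume : Measure E3) S hne
  filter_upwards [measure_eq_zero_iff_ae_notMem.1 h0] with y hy s hs
  apply hy
  rw [← sub_eq_zero.1 hs]
  simp only [hS, SetLike.mem_coe, AffineSubspace.mem_mk', vsub_eq_sub, add_sub_cancel_left]
  exact Submodule.smul_mem _ _ (Submodule.mem_span_singleton_self h)

section Potential

variable {F : Type*} [NormedAddCommGroup F] [NormedSpace ℝ F]
  {f : E3 → ℝ} {K : E3 → F} {K' : E3 → E3 →L[ℝ] F} {c : E3 → F} {C : ℝ}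

theorem sub_eq_intervalIntegral_fderiv [CompleteSpace F] (hK : ∀ z ≠ 0, HasFDerivAt K (K' z) z)
    (hk : ContinuousOn K' {0}ᶜ) (x h y : E3) (hy : ∀ s : ℝ, x + s • h - y ≠ 0) :
    K (x + h - y) - K (x - y) = ∫ s in (0 : ℝ)..1, K' (x + s • h - y) h := by
  have hd : ∀ s : ℝ, HasDerivAt (fun s : ℝ => x + s • h - y) h s := fun s => by
    simpa using (((hasDerivAt_id s).smul_const h).const_add x).sub_const y
  have hc : Continuous fun s : ℝ => K' (x + s • h - y) h := by
    have : Continuous fun s : ℝ => K' (x + s • h - y) :=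
      hk.comp_continuous (f := fun s : ℝ => x + s • h - y) (by fun_prop) hy
    exact this.clm_apply continuous_const
  rw [intervalIntegral.integral_eq_sub_of_hasDerivAt
    (f := fun s : ℝ => K (x + s • h - y))
    (fun s _ => (hK _ (hy s)).comp_hasDerivAt s (hd s)) (hc.intervalIntegrable _ _)]
  simp

theorem integrable_prod_potential [SecondCountableTopology (E3 →L[ℝ] F)] (hf : Continuous f)
    (hfi : Integrable f) (hk : ContinuousOn K' {0}ᶜ)
    (hb : ∀ z, ‖K' z‖ ≤ C * (1 / ‖z‖ ^ 2 + 1)) (x h : E3) :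
    Integrable (fun p : ℝ × E3 => f p.2 • K' (x + p.1 • h - p.2) h)
      ((volume.restrict (Set.uIoc 0 1)).prod volume) := by
  have hm := stronglyMeasurable_of_continuousOn_compl_zero hk
  have hk1 : ContinuousOn (fun z : E3 => 1 / ‖z‖ ^ 2 + 1) {0}ᶜ := by
    intro z hz
    have : ‖z‖ ^ 2 ≠ 0 := by simpa using hz
    exact ContinuousAt.continuousWithinAt (by fun_prop (disch := assumption))
  have hb1 : ∀ z : E3, ‖1 / ‖z‖ ^ 2 + 1‖ ≤ 1 * (1 / ‖z‖ ^ 2 + 1) := fun z => by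
    rw [norm_of_nonneg (by positivity), one_mul]
  have hg : Integrable (fun p : ℝ × E3 => ‖f p.2‖ • (1 / ‖x + p.1 • h - p.2‖ ^ 2 + 1))
      ((volume.restrict (Set.uIoc 0 1)).prod volume) := by
    have hmeas : AEStronglyMeasurable
        (fun p : ℝ × E3 => ‖f p.2‖ • (1 / ‖x + p.1 • h - p.2‖ ^ 2 + 1))
        ((volume.restrict (Set.uIoc 0 1)).prod volume) := by
      have := hf.measurable
      exact Measurable.aestronglyMeasurable (by fun_prop)
    rw [integrable_prod_iff hmeas]
    constructor
    · exact ae_of_all _ fun s =>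
        integrable_potential hf.norm hfi.norm hk1 zero_le_one hb1 (x + s • h)
    · have hcont := (continuous_potential hf.norm hfi.norm hk1 zero_le_one hb1).comp
        (by fun_prop : Continuous fun s : ℝ => x + s • h)
      have : IntegrableOn (fun s : ℝ =>
          ∫ y, ‖f y‖ • (1 / ‖x + s • h - y‖ ^ 2 + 1)) (Set.uIoc 0 1) :=
        (hcont.integrableOn_Icc (a := 0) (b := 1)).mono_set
          (by rw [Set.uIoc_of_le zero_le_one]; exact Set.Ioc_subset_Icc_self)
      refine Integrable.congr this (ae_of_all _ fun s =>
        integral_congr_ae (ae_of_all _ fun y => ?_))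
      simp only
      rw [norm_of_nonneg (smul_nonneg (norm_nonneg _) (by positivity))]
  refine (hg.const_mul (C * ‖h‖)).mono' ?_ (ae_of_all _ fun p => ?_)
  · refine AEStronglyMeasurable.smul ?_ ?_
    · exact Continuous.aestronglyMeasurable (by fun_prop)
    · have : StronglyMeasurable fun p : ℝ × E3 => K' (x + p.1 • h - p.2) :=
        hm.comp_measurable (by fun_prop)
      exact ((ContinuousLinearMap.apply ℝ F h).continuous.comp_stronglyMeasurable
        this).aestronglyMeasurable
  · rw [norm_smul]
    calc ‖f p.2‖ * ‖K' (x + p.1 • h - p.2) h‖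
        ≤ ‖f p.2‖ * ((C * (1 / ‖x + p.1 • h - p.2‖ ^ 2 + 1)) * ‖h‖) := by
          gcongr
          exact ((K' _).le_opNorm h).trans (by gcongr; exact hb _)
      _ = _ := by rw [smul_eq_mul]; ring

theorem potential_sub_eq_intervalIntegral [CompleteSpace F] [SecondCountableTopology (E3 →L[ℝ] F)]
    (hf : Continuous f) (hfi : Integrable f)
    (hK : ∀ z ≠ 0, HasFDerivAt K (K' z) z) (hk : ContinuousOn K' {0}ᶜ) (hC : 0 ≤ C)
    (hb : ∀ z, ‖K' z‖ ≤ C * (1 / ‖z‖ ^ 2 + 1))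
    (hint : ∀ x, Integrable (fun y => f y • (K (x - y) - c y))) (x h : E3) :
    (∫ y, f y • (K (x + h - y) - c y)) - ∫ y, f y • (K (x - y) - c y) =
      ∫ s in (0 : ℝ)..1, (∫ y, f y • K' (x + s • h - y)) h := by
  rw [← integral_sub (hint _) (hint _)]
  have h1 : ∀ᵐ y : E3, f y • (K (x + h - y) - c y) - f y • (K (x - y) - c y) =
      ∫ s in (0 : ℝ)..1, f y • K' (x + s • h - y) h := by
    filter_upwards [ae_forall_add_smul_ne x h] with y hy
    rw [intervalIntegral.integral_smul, ← sub_eq_intervalIntegral_fderiv hK hk x h y hy,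
      ← smul_sub]
    congr 1
    abel
  rw [integral_congr_ae h1]
  simp_rw [intervalIntegral.integral_of_le (zero_le_one (α := ℝ))]
  have hp := integrable_prod_potential hf hfi hk hb x h
  rw [Set.uIoc_of_le zero_le_one] at hp
  rw [← integral_integral_swap (f := fun (s : ℝ) (y : E3) => f y • K' (x + s • h - y) h) hp]
  refine integral_congr_ae (ae_of_all _ fun s => ?_)
  have := ContinuousLinearMap.integral_apply
    (integrable_potential hf hfi hk hC hb (x + s • h)) h
  simp only [this]
  rfl

theorem hasFDerivAt_potential [CompleteSpace F] [SecondCountableTopology (E3 →L[ℝ] F)]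
    (hf : Continuous f) (hfi : Integrable f)
    (hK : ∀ z ≠ 0, HasFDerivAt K (K' z) z) (hk : ContinuousOn K' {0}ᶜ) (hC : 0 ≤ C)
    (hb : ∀ z, ‖K' z‖ ≤ C * (1 / ‖z‖ ^ 2 + 1))
    (hint : ∀ x, Integrable (fun y => f y • (K (x - y) - c y))) (x : E3) :
    HasFDerivAt (fun x => ∫ y, f y • (K (x - y) - c y)) (∫ y, f y • K' (x - y)) x := by
  have hW := continuous_potential hf hfi hk hC hb
  rw [hasFDerivAt_iff_isLittleO_nhds_zero, Asymptotics.isLittleO_iff]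
  intro ε hε
  obtain ⟨δ, hδ, hball⟩ := Metric.continuousAt_iff.1 (hW.continuousAt (x := x)) ε hε
  filter_upwards [Metric.ball_mem_nhds (0 : E3) hδ] with h hh
  rw [potential_sub_eq_intervalIntegral hf hfi hK hk hC hb hint x h]
  have hWc : Continuous fun s : ℝ => (∫ y, f y • K' (x + s • h - y)) h :=
    (hW.comp (by fun_prop : Continuous fun s : ℝ => x + s • h)).clm_apply continuous_const
  have hconst : (∫ y, f y • K' (x - y)) h = ∫ _s in (0 : ℝ)..1, (∫ y, f y • K' (x - y)) h := by
    simp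
  rw [hconst, ← intervalIntegral.integral_sub (hWc.intervalIntegrable _ _) (by simp)]
  have := intervalIntegral.norm_integral_le_of_norm_le_const (a := 0) (b := 1) (C := ε * ‖h‖)
    (f := fun s : ℝ => (∫ y, f y • K' (x + s • h - y)) h - (∫ y, f y • K' (x - y)) h) ?_
  · simpa using this
  intro s hs
  rw [Set.uIoc_of_le zero_le_one] at hs
  rw [← sub_apply]
  refine (ContinuousLinearMap.le_opNorm _ _).trans ?_
  gcongr
  have hd : dist (x + s • h) x < δ := by
    rw [dist_eq_norm, add_sub_cancel_left, norm_smul, norm_of_nonneg hs.1.le]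
    have : ‖h‖ < δ := by simpa using hh
    nlinarith [norm_nonneg h, hs.2]
  have := hball hd
  rw [dist_eq_norm] at this
  exact this.le

end Potential

/-- The real inner product of `ℝ³` as a continuous bilinear map. -/
noncomputable def innerCLM : E3 →L[ℝ] E3 →L[ℝ] ℝ := innerSL ℝ

theorem innerCLM_apply (z : E3) : innerCLM z = innerSL ℝ z := rfl

/-- The derivative of `log ‖z‖` away from the origin. -/
noncomputable def logGrad (z : E3) : E3 →L[ℝ] ℝ := (‖z‖ ^ 2)⁻¹ • innerSL ℝ z

/-- The second derivative of `log ‖z‖` away from the origin. -/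
noncomputable def logHess (z : E3) : E3 →L[ℝ] E3 →L[ℝ] ℝ :=
  (‖z‖ ^ 2)⁻¹ • innerCLM - (2 * ((‖z‖ ^ 2) ^ 2)⁻¹) • (innerSL ℝ z).smulRight (innerSL ℝ z)

theorem hasFDerivAt_log_norm (z : E3) (hz : z ≠ 0) :
    HasFDerivAt (fun z : E3 => log ‖z‖) (logGrad z) z := by
  have h : ‖z‖ ^ 2 ≠ 0 := by simpa using hz
  have h1 := ((hasStrictFDerivAt_norm_sq z).hasFDerivAt.log h).const_mul (1 / 2)
  have h2 : (fun z : E3 => 1 / 2 * log (‖z‖ ^ 2)) = fun z => log ‖z‖ := by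
    ext z; rw [log_pow]; push_cast; ring
  rw [h2] at h1
  refine h1.congr_fderiv ?_
  ext v
  simp [logGrad]
  ring

theorem hasFDerivAt_logGrad (z : E3) (hz : z ≠ 0) : HasFDerivAt logGrad (logHess z) z := by
  have h : ‖z‖ ^ 2 ≠ 0 := by simpa using hz
  have h1 := (hasDerivAt_inv h).comp_hasFDerivAt z (hasStrictFDerivAt_norm_sq z).hasFDerivAt
  have h2 := h1.smul innerCLM.hasFDerivAt
  refine h2.congr_fderiv ?_
  ext v w
  simp [logHess, innerCLM_apply]
  ring

theorem continuousOn_logHess : ContinuousOn logHess {0}ᶜ := by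
  intro z hz
  have h : ‖z‖ ^ 2 ≠ 0 := by simpa using hz
  have h' : (‖z‖ ^ 2) ^ 2 ≠ 0 := pow_ne_zero 2 h
  refine ContinuousAt.continuousWithinAt ?_
  have h1 : ContinuousAt (fun z : E3 => (innerSL ℝ z).smulRight (innerSL ℝ z)) z := by
    have : Continuous fun z : E3 => ContinuousLinearMap.smulRightL ℝ E3 (E3 →L[ℝ] ℝ)
        (innerSL ℝ z) (innerSL ℝ z) := by fun_prop
    exact this.continuousAt
  unfold logHess
  have h2 : ContinuousAt (fun z : E3 => (‖z‖ ^ 2)⁻¹) z := by fun_prop (disch := assumption)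
  have h3 : ContinuousAt (fun z : E3 => 2 * ((‖z‖ ^ 2) ^ 2)⁻¹) z := by
    fun_prop (disch := assumption)
  exact (h2.smul continuousAt_const).sub (h3.smul h1)

theorem continuousOn_logGrad : ContinuousOn logGrad {0}ᶜ := fun z hz =>
  (hasFDerivAt_logGrad z hz).continuousAt.continuousWithinAt

theorem norm_logGrad_le (z : E3) : ‖logGrad z‖ ≤ 1 * (1 / ‖z‖ ^ 2 + 1) := by
  rw [logGrad, norm_smul, innerSL_apply_norm, norm_of_nonneg (by positivity), one_mul]
  rcases eq_or_ne z 0 with rfl | hz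
  · simp
  have h : 0 < ‖z‖ := norm_pos_iff.2 hz
  rw [inv_mul_eq_div, ← sub_nonneg]
  have : 1 / ‖z‖ ^ 2 + 1 - ‖z‖ / ‖z‖ ^ 2 = (1 - ‖z‖ + ‖z‖ ^ 2) / ‖z‖ ^ 2 := by
    field_simp; ring
  rw [this]
  apply div_nonneg _ (by positivity)
  nlinarith [sq_nonneg (‖z‖ - 1)]

theorem norm_logHess_le (z : E3) : ‖logHess z‖ ≤ 3 * (1 / ‖z‖ ^ 2 + 1) := by
  refine ContinuousLinearMap.opNorm_le_bound _ (by positivity) fun v => ?_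
  have h0 : logHess z v = (‖z‖ ^ 2)⁻¹ • innerSL ℝ v -
      (2 * ((‖z‖ ^ 2) ^ 2)⁻¹ * inner ℝ z v) • innerSL ℝ z := by
    simp [logHess, innerCLM_apply, mul_smul]
  have h1 : ‖(‖z‖ ^ 2)⁻¹ • innerSL ℝ v‖ = (‖z‖ ^ 2)⁻¹ * ‖v‖ := by
    rw [norm_smul, norm_of_nonneg (by positivity), innerSL_apply_norm]
  have h2 : ‖(2 * ((‖z‖ ^ 2) ^ 2)⁻¹ * inner ℝ z v) • innerSL ℝ z‖ ≤ 2 * (‖z‖ ^ 2)⁻¹ * ‖v‖ := by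
    rw [norm_smul, norm_mul, norm_of_nonneg (by positivity), innerSL_apply_norm]
    calc 2 * ((‖z‖ ^ 2) ^ 2)⁻¹ * ‖inner ℝ z v‖ * ‖z‖
        ≤ 2 * ((‖z‖ ^ 2) ^ 2)⁻¹ * (‖z‖ * ‖v‖) * ‖z‖ := by gcongr; exact norm_inner_le_norm z v
      _ = _ := by
        rcases eq_or_ne ‖z‖ 0 with h | h
        · simp [h]
        · field_simp
  rw [h0]
  refine (norm_sub_le _ _).trans ?_
  rw [h1, one_div]
  calc _ ≤ (‖z‖ ^ 2)⁻¹ * ‖v‖ + 2 * (‖z‖ ^ 2)⁻¹ * ‖v‖ := by gcongr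
    _ = 3 * (‖z‖ ^ 2)⁻¹ * ‖v‖ := by ring
    _ ≤ _ := by gcongr; linarith

theorem sum_logHess_single (z : E3) (hz : z ≠ 0) :
    ∑ i, logHess z (EuclideanSpace.single i 1) (EuclideanSpace.single i 1) = 1 / ‖z‖ ^ 2 := by
  have h : ‖z‖ ≠ 0 := by simpa using hz
  have h2 : ‖z‖ ^ 2 = z 0 ^ 2 + z 1 ^ 2 + z 2 ^ 2 := by
    rw [EuclideanSpace.norm_sq_eq]; simp [Fin.sum_univ_three]
  simp only [logHess, innerCLM_apply, Fin.sum_univ_three, sub_apply, smul_apply,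
    ContinuousLinearMap.smulRight_apply, innerSL_apply_apply, smul_eq_mul,
    EuclideanSpace.inner_single_right]
  simp
  have e : z 0 * z 0 + z 1 * z 1 + z 2 * z 2 = ‖z‖ ^ 2 := by rw [h2]; ring
  calc _ = 3 * (‖z‖ ^ 2)⁻¹ - 2 * ((‖z‖ ^ 2) ^ 2)⁻¹ * (z 0 * z 0 + z 1 * z 1 + z 2 * z 2) := by ring
    _ = _ := by rw [e]; field_simp; norm_num

theorem abs_log_norm_sub_le {x y : E3} (hy : y ≠ 0) (hxy : x - y ≠ 0) :
    |log ‖x - y‖ - log ‖y‖| ≤ ‖x‖ * (1 / ‖x - y‖ + 1 / ‖y‖) := by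
  have h1 : 0 < ‖y‖ := norm_pos_iff.2 hy
  have h2 : 0 < ‖x - y‖ := norm_pos_iff.2 hxy
  have t1 : ‖y‖ ≤ ‖x - y‖ + ‖x‖ := by
    calc ‖y‖ = ‖x - (x - y)‖ := by congr 1; abel
      _ ≤ _ := (norm_sub_le _ _).trans (by linarith)
  have t2 : ‖x - y‖ ≤ ‖x‖ + ‖y‖ := norm_sub_le _ _
  have a1 : log ‖x - y‖ - log ‖y‖ ≤ ‖x‖ * (1 / ‖y‖) := by
    rw [← log_div h2.ne' h1.ne']
    refine (log_le_sub_one_of_pos (by positivity)).trans ?_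
    rw [sub_le_iff_le_add, mul_one_div, div_add_one h1.ne']
    gcongr
  have a2 : log ‖y‖ - log ‖x - y‖ ≤ ‖x‖ * (1 / ‖x - y‖) := by
    rw [← log_div h1.ne' h2.ne']
    refine (log_le_sub_one_of_pos (by positivity)).trans ?_
    rw [sub_le_iff_le_add, mul_one_div, div_add_one h2.ne']
    gcongr
    linarith
  have p1 : 0 ≤ ‖x‖ * (1 / ‖y‖) := by positivity
  have p2 : 0 ≤ ‖x‖ * (1 / ‖x - y‖) := by positivity
  rw [abs_le, mul_add]
  constructor <;> linarith

theorem integrable_inv_norm_potential {f : E3 → ℝ} (hf : Continuous f) (hfi : Integrable f)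
    (x : E3) : Integrable (fun y => f y * (1 / ‖x - y‖)) := by
  refine integrable_potential (k := fun z : E3 => 1 / ‖z‖) hf hfi ?_ zero_le_one ?_ x
  · intro z hz
    have : ‖z‖ ≠ 0 := by simpa using hz
    exact ContinuousAt.continuousWithinAt (by fun_prop (disch := assumption))
  · intro z
    have := norm_logGrad_le z
    rw [logGrad, norm_smul, innerSL_apply_norm, norm_of_nonneg (by positivity)] at this
    rw [norm_of_nonneg (by positivity)]
    refine le_trans (le_of_eq ?_) this
    rcases eq_or_ne ‖z‖ 0 with h | h
    · simp [h]
    · field_simp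

theorem integrable_log_potential {f : E3 → ℝ} (hf : Continuous f) (hfi : Integrable f)
    (x : E3) : Integrable (fun y => f y • (log ‖x - y‖ - log ‖y‖)) := by
  have h1 := (integrable_inv_norm_potential hf hfi x).norm
  have h2 := (integrable_inv_norm_potential hf hfi 0).norm
  refine ((h1.add h2).const_mul ‖x‖).mono' ?_ ?_
  · have := hf.measurable
    exact Measurable.aestronglyMeasurable (by fun_prop)
  · filter_upwards [Measure.ae_ne volume x, Measure.ae_ne volume 0] with y hx hy
    rw [norm_smul]
    calc ‖f y‖ * ‖log ‖x - y‖ - log ‖y‖‖ ≤ ‖f y‖ * (‖x‖ * (1 / ‖x - y‖ + 1 / ‖y‖)) := by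
          gcongr
          exact abs_log_norm_sub_le hy (sub_ne_zero.2 hx.symm)
      _ = _ := by simp; ring

theorem hasFDerivAt_log_potential {f : E3 → ℝ} (hf : Continuous f) (hfi : Integrable f) (x : E3) :
    HasFDerivAt (fun x => ∫ y, f y • (log ‖x - y‖ - log ‖y‖)) (∫ y, f y • logGrad (x - y)) x :=
  hasFDerivAt_potential (c := fun y : E3 => log ‖y‖) hf hfi hasFDerivAt_log_norm
    continuousOn_logGrad zero_le_one norm_logGrad_le (integrable_log_potential hf hfi) x

theorem hasFDerivAt_logGrad_potential {f : E3 → ℝ} (hf : Continuous f) (hfi : Integrable f)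
    (x : E3) :
    HasFDerivAt (fun x => ∫ y, f y • logGrad (x - y)) (∫ y, f y • logHess (x - y)) x := by
  have h := hasFDerivAt_potential (c := fun _ => 0) hf hfi hasFDerivAt_logGrad
    continuousOn_logHess zero_le_three norm_logHess_le (fun x => by
      simpa using integrable_potential hf hfi continuousOn_logGrad zero_le_one norm_logGrad_le x) x
  simpa using h

theorem continuous_logHess_potential {f : E3 → ℝ} (hf : Continuous f) (hfi : Integrable f) :
    Continuous (fun x => ∫ y, f y • logHess (x - y)) :=
  continuous_potential hf hfi continuousOn_logHess zero_le_three norm_logHess_le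

theorem contDiff_two_log_potential {f : E3 → ℝ} (hf : Continuous f) (hfi : Integrable f) :
    ContDiff ℝ 2 (fun x => ∫ y, f y • (log ‖x - y‖ - log ‖y‖)) := by
  have h1 : ContDiff ℝ 1 (fun x => ∫ y, f y • logGrad (x - y)) := by
    rw [contDiff_one_iff_hasFDerivAt]
    exact ⟨_, continuous_logHess_potential hf hfi, hasFDerivAt_logGrad_potential hf hfi⟩
  have : (2 : WithTop ℕ∞) = (1 : ℕ) + 1 := by norm_num
  rw [this, contDiff_succ_iff_hasFDerivAt]
  exact ⟨_, by exact_mod_cast h1, hasFDerivAt_log_potential hf hfi⟩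

theorem lap_log_potential {f : E3 → ℝ} (hf : Continuous f) (hfi : Integrable f) (x : E3) :
    lap (fun x => ∫ y, f y • (log ‖x - y‖ - log ‖y‖)) x = ∫ y, f y / ‖x - y‖ ^ 2 := by
  have h1 : ∀ x, fderiv ℝ (fun x => ∫ y, f y • (log ‖x - y‖ - log ‖y‖)) x =
    ∫ y, f y • logGrad (x - y) := fun x => (hasFDerivAt_log_potential hf hfi x).fderiv
  have hi := integrable_potential (k := logHess) hf hfi
    continuousOn_logHess zero_le_three norm_logHess_le x
  have h2 : ∀ e : E3, fderiv ℝ (fun x => (∫ y, f y • logGrad (x - y)) e) x e =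
      ∫ y, f y * logHess (x - y) e e := by
    intro e
    have := (hasFDerivAt_logGrad_potential hf hfi x).clm_apply (hasFDerivAt_const e x)
    rw [this.fderiv]
    simp only [ContinuousLinearMap.comp_zero, zero_add, ContinuousLinearMap.flip_apply]
    rw [ContinuousLinearMap.integral_apply hi, ContinuousLinearMap.integral_apply]
    · rfl
    · exact hi.apply_continuousLinearMap e
  unfold lap
  simp_rw [h1, h2]
  rw [← integral_finsetSum]
  · refine integral_congr_ae ?_
    filter_upwards [Measure.ae_ne volume x] with y hy
    rw [← Finset.mul_sum, sum_logHess_single _ (sub_ne_zero.2 hy.symm), mul_one_div]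
  · intro i _
    exact (hi.apply_continuousLinearMap (EuclideanSpace.single i (1 : ℝ))).apply_continuousLinearMap
      (EuclideanSpace.single i (1 : ℝ))

theorem solV_eq_log_potential (u : E3 → ℝ) : solV u = fun x =>
    -(1 / π ^ 2) * ∫ y, exp (3 * u y) • (log ‖x - y‖ - log ‖y‖) := by
  ext x
  rw [solV, neg_mul, ← mul_neg, ← integral_neg]
  congr 1
  refine integral_congr_ae ?_
  filter_upwards [Measure.ae_ne volume x, Measure.ae_ne volume 0] with y hx hy
  rw [log_div (norm_ne_zero_iff.2 hy) (norm_ne_zero_iff.2 (sub_ne_zero.2 hx.symm)), smul_eq_mul]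
  ring

theorem lap_const_mul (c : ℝ) (f : E3 → ℝ) (x : E3) :
    lap (fun x => c * f x) x = c * lap f x := by
  have h (g : E3 → ℝ) (x : E3) : fderiv ℝ (fun x => c * g x) x = c • fderiv ℝ g x :=
    congrFun (fderiv_const_smul_field (𝕜 := ℝ) (f := g) c) x
  unfold lap
  simp only [h, smul_apply, smul_eq_mul, Finset.mul_sum]

/-- The symmetric second difference `2φ(x) - φ(x+z) - φ(x-z)`. -/
noncomputable def secondDiff (φ : E3 → ℝ) (x z : E3) : ℝ := 2 * φ x - φ (x + z) - φ (x - z)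

theorem exists_schwartz_decay (φ : SchwartzMap E3 ℝ) (n k : ℕ) :
    ∃ C : ℝ, 0 ≤ C ∧ ∀ x, (1 + ‖x‖) ^ k * ‖iteratedFDeriv ℝ n φ x‖ ≤ C := by
  refine ⟨_, ?_, fun x => SchwartzMap.one_add_le_sup_seminorm_apply (𝕜 := ℝ) (m := (k, n))
    le_rfl le_rfl φ x⟩
  positivity

theorem one_add_norm_le_mul (x z : E3) : 1 + ‖x‖ ≤ (1 + ‖x + z‖) * (1 + ‖z‖) := by
  have : ‖x‖ ≤ ‖x + z‖ + ‖z‖ := by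
    calc ‖x‖ = ‖x + z - z‖ := by simp
      _ ≤ _ := norm_sub_le _ _
  nlinarith [mul_nonneg (norm_nonneg (x + z)) (norm_nonneg z)]

theorem one_add_norm_pow_le_mul (x z : E3) (n : ℕ) :
    (1 + ‖x‖) ^ n ≤ (1 + ‖x + z‖) ^ n * (1 + ‖z‖) ^ n := by
  rw [← mul_pow]
  gcongr
  exact one_add_norm_le_mul x z

theorem exists_secondDiff_le_near (φ : SchwartzMap E3 ℝ) :
    ∃ C : ℝ, 0 ≤ C ∧ ∀ x z : E3, ‖z‖ ≤ 1 → (1 + ‖x‖) ^ 4 * |secondDiff φ x z| ≤ C * ‖z‖ ^ 2 := by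
  obtain ⟨C, hC, hφ⟩ := exists_schwartz_decay φ 2 4
  refine ⟨16 * C, by positivity, fun x z hz => ?_⟩
  have hx : 0 < 1 + ‖x‖ := by positivity
  set M := 16 * C / (1 + ‖x‖) ^ 4 with hM
  have hM0 : 0 ≤ M := by positivity
  have hsm : ContDiff ℝ 2 φ := φ.smooth 2
  have hd : Differentiable ℝ φ := φ.differentiable
  have hd1 : Differentiable ℝ (fderiv ℝ φ) :=
    (hsm.fderiv_right (m := 1) (by norm_num)).differentiable (by norm_num)
  have hbound : ∀ w ∈ Metric.closedBall x 1, ‖fderiv ℝ (fderiv ℝ φ) w‖ ≤ M := by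
    intro w hw
    have h1 := hφ w
    rw [← norm_iteratedFDeriv_fderiv, norm_iteratedFDeriv_one] at h1
    have h2 := one_add_norm_pow_le_mul x (w - x) 4
    have h3 : (1 + ‖w - x‖) ^ 4 ≤ 2 ^ 4 := by
      rw [mem_closedBall_iff_norm] at hw
      gcongr; linarith
    rw [add_sub_cancel] at h2
    rw [hM, le_div_iff₀ (by positivity)]
    calc ‖fderiv ℝ (fderiv ℝ φ) w‖ * (1 + ‖x‖) ^ 4
        ≤ ‖fderiv ℝ (fderiv ℝ φ) w‖ * ((1 + ‖w‖) ^ 4 * 2 ^ 4) := by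
          gcongr
          exact h2.trans (by gcongr)
      _ = 16 * ((1 + ‖w‖) ^ 4 * ‖fderiv ℝ (fderiv ℝ φ) w‖) := by ring
      _ ≤ 16 * C := by gcongr
  have hball := convex_closedBall x 1
  have hLip : ∀ a ∈ Metric.closedBall x 1, ∀ b ∈ Metric.closedBall x 1,
      ‖fderiv ℝ φ b - fderiv ℝ φ a‖ ≤ M * ‖b - a‖ := fun a ha b hb =>
    hball.norm_image_sub_le_of_norm_fderiv_le (fun w _ => hd1 w) hbound ha hb
  have hseg : ∀ w ∈ segment ℝ (x - z) x, w ∈ Metric.closedBall x 1 ∧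
      w + z ∈ Metric.closedBall x 1 := by
    rintro w ⟨a, b, ha, hb, hab, rfl⟩
    have hz' : ∀ t : ℝ, 0 ≤ t → t ≤ 1 → t * ‖z‖ ≤ 1 := fun t h0 h1 => by
      nlinarith [norm_nonneg z]
    constructor <;> rw [mem_closedBall_iff_norm]
    · have : a • (x - z) + b • x - x = -(a • z) := by
        rw [← eq_sub_iff_add_eq'] at hab; subst hab; module
      rw [this, norm_neg, norm_smul, norm_of_nonneg ha]
      exact hz' a ha (by linarith)
    · have : a • (x - z) + b • x + z - x = b • z := by
        rw [← eq_sub_iff_add_eq] at hab; subst hab; module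
      rw [this, norm_smul, norm_of_nonneg hb]
      exact hz' b hb (by linarith)
  have hfd : ∀ w, HasFDerivAt (fun w => φ (w + z) - φ w)
      (fderiv ℝ φ (w + z) - fderiv ℝ φ w) w := fun w =>
    ((hasFDerivAt_comp_add_right z).2 (hd (w + z)).hasFDerivAt).sub (hd w).hasFDerivAt
  have key := (convex_segment (𝕜 := ℝ) (x - z) x).norm_image_sub_le_of_norm_hasFDerivWithin_le
    (C := M * ‖z‖) (fun w _ => (hfd w).hasFDerivWithinAt) (fun w hw => by
      have := hLip w (hseg w hw).1 (w + z) (hseg w hw).2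
      simpa using this) (left_mem_segment ℝ _ _) (right_mem_segment ℝ _ _)
  have e : secondDiff φ x z = -((φ (x + z) - φ x) - (φ (x - z + z) - φ (x - z))) := by
    rw [secondDiff, sub_add_cancel]; ring
  have h4 : |secondDiff φ x z| ≤ M * ‖z‖ ^ 2 := by
    rw [e, abs_neg, ← norm_eq_abs]
    refine key.trans (le_of_eq ?_)
    rw [sub_sub_cancel]; ring
  calc (1 + ‖x‖) ^ 4 * |secondDiff φ x z| ≤ (1 + ‖x‖) ^ 4 * (M * ‖z‖ ^ 2) := by gcongr
    _ = _ := by rw [hM]; field_simp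

theorem secondDiff_weighted_le (φ : E3 → ℝ) (x z : E3) (hz : 1 ≤ ‖z‖) :
    (1 + ‖x‖) ^ 4 * (|secondDiff φ x z| / ‖z‖ ^ 4) ≤
      2 * ((1 + ‖x‖) ^ 4 * |φ x|) * (min 1 (‖z‖ ^ 2) / ‖z‖ ^ 4) +
      16 * ((1 + ‖x + z‖) ^ 4 * |φ (x + z)|) + 16 * ((1 + ‖x - z‖) ^ 4 * |φ (x - z)|) := by
  have hz4 : (1 + ‖z‖) ^ 4 ≤ 16 * ‖z‖ ^ 4 := by
    calc (1 + ‖z‖) ^ 4 ≤ (2 * ‖z‖) ^ 4 := by gcongr; linarith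
      _ = _ := by ring
  have hmin : min 1 (‖z‖ ^ 2) = 1 := min_eq_left (by nlinarith)
  have h1 : (1 + ‖x‖) ^ 4 ≤ (1 + ‖x + z‖) ^ 4 * (16 * ‖z‖ ^ 4) :=
    (one_add_norm_pow_le_mul x z 4).trans (by gcongr)
  have h2 : (1 + ‖x‖) ^ 4 ≤ (1 + ‖x - z‖) ^ 4 * (16 * ‖z‖ ^ 4) := by
    have := one_add_norm_pow_le_mul x (-z) 4
    rw [norm_neg, ← sub_eq_add_neg] at this
    exact this.trans (by gcongr)
  have habs : |secondDiff φ x z| ≤ 2 * |φ x| + |φ (x + z)| + |φ (x - z)| := by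
    have a1 := abs_sub (2 * φ x - φ (x + z)) (φ (x - z))
    have a2 := abs_sub (2 * φ x) (φ (x + z))
    rw [abs_mul, abs_two] at a2
    rw [secondDiff]
    linarith
  have hzp : 0 < ‖z‖ := by linarith
  rw [hmin, mul_div_assoc', div_le_iff₀ (by positivity)]
  calc (1 + ‖x‖) ^ 4 * |secondDiff φ x z|
      ≤ (1 + ‖x‖) ^ 4 * (2 * |φ x| + |φ (x + z)| + |φ (x - z)|) := by gcongr
    _ = 2 * ((1 + ‖x‖) ^ 4 * |φ x|) + (1 + ‖x‖) ^ 4 * |φ (x + z)|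
        + (1 + ‖x‖) ^ 4 * |φ (x - z)| := by ring
    _ ≤ 2 * ((1 + ‖x‖) ^ 4 * |φ x|) + (1 + ‖x + z‖) ^ 4 * (16 * ‖z‖ ^ 4) * |φ (x + z)|
        + (1 + ‖x - z‖) ^ 4 * (16 * ‖z‖ ^ 4) * |φ (x - z)| := by gcongr
    _ = _ := by field_simp

theorem integrable_weighted_schwartz (φ : SchwartzMap E3 ℝ) :
    Integrable (fun w => (1 + ‖w‖) ^ 4 * |φ w|) := by
  obtain ⟨C, hC, hφ⟩ := exists_schwartz_decay φ 0 8
  refine (integrable_inv_one_add_norm_pow_four.const_mul C).mono' ?_ (ae_of_all _ fun w => ?_)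
  · have := φ.continuous
    exact Continuous.aestronglyMeasurable (by fun_prop)
  · have h := hφ w
    rw [norm_iteratedFDeriv_zero, norm_eq_abs] at h
    rw [norm_of_nonneg (by positivity), mul_one_div, le_div_iff₀ (by positivity)]
    calc _ = (1 + ‖w‖) ^ 8 * |φ w| := by ring
      _ ≤ C := h

theorem exists_secondDiff_weighted_le (φ : SchwartzMap E3 ℝ) :
    ∃ C : ℝ, 0 ≤ C ∧ ∀ x z : E3, (1 + ‖x‖) ^ 4 * (|secondDiff φ x z| / ‖z‖ ^ 4) ≤
      C * (min 1 (‖z‖ ^ 2) / ‖z‖ ^ 4) +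
      16 * ((1 + ‖x + z‖) ^ 4 * |φ (x + z)|) + 16 * ((1 + ‖x - z‖) ^ 4 * |φ (x - z)|) := by
  obtain ⟨C₁, hC₁, h1⟩ := exists_secondDiff_le_near φ
  obtain ⟨C₂, hC₂, h2⟩ := exists_schwartz_decay φ 0 4
  refine ⟨C₁ + 2 * C₂, by positivity, fun x z => ?_⟩
  rcases le_total 1 ‖z‖ with hz | hz
  · refine (secondDiff_weighted_le φ x z hz).trans ?_
    have := h2 x
    rw [norm_iteratedFDeriv_zero, norm_eq_abs] at this
    gcongr
    linarith
  · have hmin : min 1 (‖z‖ ^ 2) = ‖z‖ ^ 2 := min_eq_right (by nlinarith [norm_nonneg z])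
    have : (1 + ‖x‖) ^ 4 * (|secondDiff φ x z| / ‖z‖ ^ 4) ≤
        (C₁ + 2 * C₂) * (min 1 (‖z‖ ^ 2) / ‖z‖ ^ 4) := by
      rw [hmin, mul_div_assoc', mul_div_assoc']
      refine div_le_div_of_nonneg_right ((h1 x z hz).trans ?_) (by positivity)
      gcongr; linarith
    have p1 : 0 ≤ 16 * ((1 + ‖x + z‖) ^ 4 * |φ (x + z)|) := by positivity
    have p2 : 0 ≤ 16 * ((1 + ‖x - z‖) ^ 4 * |φ (x - z)|) := by positivity
    linarith

theorem continuous_secondDiff (φ : SchwartzMap E3 ℝ) :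
    Continuous fun p : E3 × E3 => secondDiff φ p.1 p.2 := by
  have := φ.continuous
  unfold secondDiff
  fun_prop

theorem measurable_secondDiff_div (φ : SchwartzMap E3 ℝ) :
    Measurable fun p : E3 × E3 => secondDiff φ p.1 p.2 / ‖p.2‖ ^ 4 :=
  (continuous_secondDiff φ).measurable.div (by fun_prop)

theorem exists_secondDiff_integral_bound (φ : SchwartzMap E3 ℝ) :
    ∃ C : ℝ, 0 ≤ C ∧ ∀ x : E3, Integrable (fun z => secondDiff φ x z / ‖z‖ ^ 4) ∧
      (1 + ‖x‖) ^ 4 * |∫ z, secondDiff φ x z / ‖z‖ ^ 4| ≤ C := by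
  obtain ⟨C, hC, h⟩ := exists_secondDiff_weighted_le φ
  have hA := integrable_weighted_schwartz φ
  have hk := integrable_min_div_norm_pow_four
  refine ⟨C * (∫ z : E3, min 1 (‖z‖ ^ 2) / ‖z‖ ^ 4) + 16 * (∫ w, (1 + ‖w‖) ^ 4 * |φ w|) +
    16 * (∫ w, (1 + ‖w‖) ^ 4 * |φ w|), by positivity, fun x => ?_⟩
  have i1 : Integrable fun z : E3 => C * (min 1 (‖z‖ ^ 2) / ‖z‖ ^ 4) := hk.const_mul C
  have i2 : Integrable fun z : E3 => 16 * ((1 + ‖x + z‖) ^ 4 * |φ (x + z)|) :=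
    (hA.comp_add_left x).const_mul 16
  have i3 : Integrable fun z : E3 => 16 * ((1 + ‖x - z‖) ^ 4 * |φ (x - z)|) :=
    (hA.comp_sub_left x).const_mul 16
  have hm : Measurable fun z => secondDiff φ x z / ‖z‖ ^ 4 :=
    (measurable_secondDiff_div φ).comp (by fun_prop : Measurable fun z : E3 => (x, z))
  have hb : ∀ z : E3, ‖(1 + ‖x‖) ^ 4 * (secondDiff φ x z / ‖z‖ ^ 4)‖ ≤
      C * (min 1 (‖z‖ ^ 2) / ‖z‖ ^ 4) + 16 * ((1 + ‖x + z‖) ^ 4 * |φ (x + z)|) +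
        16 * ((1 + ‖x - z‖) ^ 4 * |φ (x - z)|) := fun z => by
    rw [norm_mul, norm_div, norm_of_nonneg (by positivity : 0 ≤ (1 + ‖x‖) ^ 4),
      norm_of_nonneg (by positivity : 0 ≤ ‖z‖ ^ 4), norm_eq_abs]
    exact h x z
  have hi : Integrable (fun z => (1 + ‖x‖) ^ 4 * (secondDiff φ x z / ‖z‖ ^ 4)) :=
    ((i1.add i2).add i3).mono' (hm.const_mul _).aestronglyMeasurable (ae_of_all _ hb)
  constructor
  · have hx : (1 + ‖x‖) ^ 4 ≠ 0 := by positivity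
    exact (integrable_const_mul_iff (IsUnit.mk0 _ hx) _).1 hi
  · have := norm_integral_le_of_norm_le ((i1.add i2).add i3) (ae_of_all _ hb)
    rw [integral_const_mul, norm_mul, norm_of_nonneg (by positivity : 0 ≤ (1 + ‖x‖) ^ 4),
      norm_eq_abs] at this
    refine this.trans (le_of_eq ?_)
    rw [integral_add' (i1.add i2) i3, integral_add' i1 i2]
    simp only [integral_const_mul]
    rw [integral_add_left_eq_self (fun w => (1 + ‖w‖) ^ 4 * |φ w|) x,
      integral_sub_left_eq_self (fun w => (1 + ‖w‖) ^ 4 * |φ w|) volume x]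

theorem integrable_indicator_sub_div (φ : SchwartzMap E3 ℝ) (x : E3) {ε : ℝ} (hε : 0 < ε) :
    Integrable ({z : E3 | ε < ‖z‖}.indicator fun z => (φ x - φ (x - z)) / ‖z‖ ^ 4) := by
  obtain ⟨M, hM, h⟩ := exists_schwartz_decay φ 0 0
  have hb : ∀ w, |φ w| ≤ M := fun w => by simpa using h w
  have hφ := φ.continuous
  have hs : MeasurableSet {z : E3 | ε < ‖z‖} := measurableSet_lt measurable_const measurable_norm
  have hc : 0 < min 1 (ε ^ 2) := by positivity
  refine (integrable_min_div_norm_pow_four.const_mul (2 * M / min 1 (ε ^ 2))).mono' ?_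
    (ae_of_all _ fun z => ?_)
  · exact ((Measurable.div (by fun_prop) (by fun_prop)).indicator hs).aestronglyMeasurable
  · by_cases hz : ε < ‖z‖
    · rw [Set.indicator_of_mem (by exact hz), norm_div,
        norm_of_nonneg (by positivity : 0 ≤ ‖z‖ ^ 4), mul_div_assoc']
      refine div_le_div_of_nonneg_right ?_ (by positivity)
      have h1 : ‖φ x - φ (x - z)‖ ≤ 2 * M := by
        have := norm_sub_le (φ x) (φ (x - z))
        simp only [norm_eq_abs] at this ⊢
        linarith [hb x, hb (x - z)]
      have h2 : min 1 (ε ^ 2) ≤ min 1 (‖z‖ ^ 2) := by gcongr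
      rw [div_mul_eq_mul_div, le_div_iff₀ hc]
      gcongr
    · rw [Set.indicator_of_notMem (by exact hz), norm_zero]
      positivity

theorem setIntegral_sub_div_eq (φ : SchwartzMap E3 ℝ) (x : E3) {ε : ℝ} (hε : 0 < ε) :
    ∫ y in {y : E3 | ε < ‖x - y‖}, (φ x - φ y) / ‖x - y‖ ^ 4 =
      (1 / 2) * ∫ z, {z : E3 | ε < ‖z‖}.indicator (fun z => secondDiff φ x z / ‖z‖ ^ 4) z := by
  set G : E3 → ℝ := {z : E3 | ε < ‖z‖}.indicator fun z => (φ x - φ (x - z)) / ‖z‖ ^ 4 with hG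
  have hGi : Integrable G := integrable_indicator_sub_div φ x hε
  have hs : MeasurableSet {y : E3 | ε < ‖x - y‖} := measurableSet_lt (by fun_prop) (by fun_prop)
  have h1 : ∫ y in {y : E3 | ε < ‖x - y‖}, (φ x - φ y) / ‖x - y‖ ^ 4 = ∫ z, G z := by
    rw [← integral_sub_left_eq_self G volume x, ← integral_indicator hs]
    refine integral_congr_ae (ae_of_all _ fun y => ?_)
    simp [hG, Set.indicator]
  have h2 : ∫ z, G z + G (-z) = 2 * ∫ z, G z := by
    rw [integral_add hGi hGi.comp_neg, integral_neg_eq_self]; ring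
  rw [h1, ← mul_right_inj' (two_ne_zero (α := ℝ)), ← h2, ← mul_assoc]
  norm_num
  refine integral_congr_ae (ae_of_all _ fun z => ?_)
  by_cases hz : ε < ‖z‖
  · simp only [hG, Set.indicator, Set.mem_ofPred_eq, hz, norm_neg, if_true, secondDiff]
    rw [sub_neg_eq_add]; ring
  · simp [hG, Set.indicator, hz]

theorem halfLap_eq (φ : SchwartzMap E3 ℝ) (x : E3) :
    halfLap φ x = 1 / (2 * π ^ 2) * ∫ z, secondDiff φ x z / ‖z‖ ^ 4 := by
  obtain ⟨C, -, h⟩ := exists_secondDiff_integral_bound φ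
  have hi := (h x).1
  refine Tendsto.limUnder_eq ?_
  have hlim : Tendsto (fun ε : ℝ => ∫ z,
      {z : E3 | ε < ‖z‖}.indicator (fun z => secondDiff φ x z / ‖z‖ ^ 4) z)
      (nhdsWithin 0 (Set.Ioi 0)) (nhds (∫ z, secondDiff φ x z / ‖z‖ ^ 4)) := by
    refine tendsto_integral_filter_of_dominated_convergence _ ?_ ?_ hi.norm ?_
    · exact Eventually.of_forall fun ε => hi.aestronglyMeasurable.indicator
        (measurableSet_lt measurable_const measurable_norm)
    · exact Eventually.of_forall fun ε => ae_of_all _ fun z => norm_indicator_le_norm_self _ _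
    · refine ae_of_all _ fun z => ?_
      rcases eq_or_ne z 0 with rfl | hz
      · have : secondDiff φ x 0 = 0 := by simp [secondDiff]; ring
        refine tendsto_const_nhds.congr fun ε => ?_
        simp [Set.indicator_apply, this]
      · refine tendsto_const_nhds.congr' ?_
        have : ∀ᶠ ε : ℝ in nhdsWithin 0 (Set.Ioi 0), ε < ‖z‖ :=
          nhdsWithin_le_nhds (gt_mem_nhds (norm_pos_iff.2 hz))
        filter_upwards [this] with ε hε
        rw [Set.indicator_of_mem (by exact hε)]
  have := (hlim.const_mul (1 / 2)).const_mul (1 / π ^ 2)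
  rw [← mul_assoc, one_div_mul_one_div, mul_comm (π ^ 2)] at this
  refine this.congr' ?_
  filter_upwards [self_mem_nhdsWithin] with ε hε
  rw [setIntegral_sub_div_eq φ x hε]

theorem exists_halfLap_bound (φ : SchwartzMap E3 ℝ) :
    ∃ C : ℝ, 0 ≤ C ∧ ∀ x, |halfLap φ x| ≤ C * (1 / (1 + ‖x‖) ^ 4) := by
  obtain ⟨C, hC, h⟩ := exists_secondDiff_integral_bound φ
  refine ⟨1 / (2 * π ^ 2) * C, by positivity, fun x => ?_⟩
  rw [halfLap_eq, abs_mul, abs_of_nonneg (by positivity : 0 ≤ 1 / (2 * π ^ 2)), mul_assoc]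
  gcongr
  rw [mul_one_div, le_div_iff₀ (by positivity), mul_comm]
  exact (h x).2

theorem stronglyMeasurable_halfLap (φ : SchwartzMap E3 ℝ) : StronglyMeasurable (halfLap φ) := by
  have : halfLap φ = fun x => 1 / (2 * π ^ 2) * ∫ z, secondDiff φ x z / ‖z‖ ^ 4 :=
    funext (halfLap_eq φ)
  rw [this]
  exact ((measurable_secondDiff_div φ).stronglyMeasurable.integral_prod_right).const_mul _

/-- The integral `∫₀^∞ s^{-3/2} e^{-b/s} ds = √(π/b)`. -/
theorem integrableOn_rpow_mul_exp_neg_div {b : ℝ} (hb : 0 < b) :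
    IntegrableOn (fun s : ℝ => s ^ (-3 / 2 : ℝ) * exp (-b / s)) (Set.Ioi 0) ∧
    ∫ s in Set.Ioi (0 : ℝ), s ^ (-3 / 2 : ℝ) * exp (-b / s) = √(π / b) := by
  have hp : (-1 / 2 : ℝ) ≠ 0 := by norm_num
  have e : Set.EqOn (fun s : ℝ => (|(-1 / 2 : ℝ)| * s ^ ((-1 / 2 : ℝ) - 1)) •
      exp (-b * (s ^ (-1 / 2 : ℝ)) ^ 2)) (fun s => (1 / 2) * (s ^ (-3 / 2 : ℝ) * exp (-b / s)))
      (Set.Ioi 0) := fun s hs => by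
    have hs' : (0 : ℝ) < s := hs
    have h1 : (s ^ (-1 / 2 : ℝ)) ^ 2 = s⁻¹ := by
      rw [← rpow_natCast, ← rpow_mul hs'.le]; norm_num [rpow_neg_one]
    simp only [smul_eq_mul]
    rw [h1, abs_of_neg (by norm_num), div_eq_mul_inv (-b) s]
    norm_num
    ring
  constructor
  · have h : IntegrableOn (fun s : ℝ => exp (-b * s ^ 2)) (Set.Ioi 0) :=
      (integrable_exp_neg_mul_sq hb).integrableOn
    have h2 := (integrableOn_Ioi_comp_rpow_iff (fun s : ℝ => exp (-b * s ^ 2)) hp).2 h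
    have h3 := (h2.congr_fun e measurableSet_Ioi).const_mul 2
    refine h3.congr (ae_of_all _ fun s => ?_)
    ring
  · have h := integral_comp_rpow_Ioi (fun s : ℝ => exp (-b * s ^ 2)) hp
    rw [setIntegral_congr_fun measurableSet_Ioi e, integral_gaussian_Ioi, integral_const_mul] at h
    linarith

theorem hasDerivAt_sqrt_mul_one_sub_exp {b s : ℝ} (hs : 0 < s) :
    HasDerivAt (fun s => 2 * (√s * (1 - exp (-b / s))))
      (s ^ (-1 / 2 : ℝ) * (1 - exp (-b / s)) - 2 * b * (s ^ (-3 / 2 : ℝ) * exp (-b / s))) s := by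
  have h1 : HasDerivAt (fun s => √s) (1 / (2 * √s)) s := hasDerivAt_sqrt hs.ne'
  have h2 : HasDerivAt (fun s => -b / s) (b / s ^ 2) s := by
    refine ((hasDerivAt_const s (-b)).fun_div (hasDerivAt_id s) hs.ne').congr_deriv ?_
    simp
  have h3 := (h1.mul ((hasDerivAt_const s 1).sub h2.exp)).const_mul 2
  refine h3.congr_deriv ?_
  have r1 : s ^ (-1 / 2 : ℝ) = 1 / √s := by
    rw [sqrt_eq_rpow, one_div, ← rpow_neg hs.le]; norm_num
  have r2 : s ^ (-3 / 2 : ℝ) = 1 / (s * √s) := by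
    rw [sqrt_eq_rpow, one_div, ← rpow_one_add' hs.le (by norm_num), ← rpow_neg hs.le]; norm_num
  have hq : 0 < √s := sqrt_pos.2 hs
  have hqq : s = √s * √s := (mul_self_sqrt hs.le).symm
  simp only [Pi.sub_apply]
  rw [r1, r2]
  generalize exp (-b / s) = E
  generalize hq' : √s = q at *
  subst hqq
  field_simp
  ring

theorem one_sub_exp_neg_div_le (b s : ℝ) : 1 - exp (-b / s) ≤ b / s := by
  have := add_one_le_exp (-b / s)
  rw [neg_div] at *
  linarith

theorem integral_rpow_mul_one_sub_exp {b : ℝ} (hb : 0 ≤ b) :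
    IntegrableOn (fun s : ℝ => s ^ (-1 / 2 : ℝ) * (1 - exp (-b / s))) (Set.Ioi 0) ∧
    ∫ s in Set.Ioi (0 : ℝ), s ^ (-1 / 2 : ℝ) * (1 - exp (-b / s)) = 2 * √(π * b) := by
  rcases hb.eq_or_lt with rfl | hb
  · simp
  obtain ⟨hJ, hJ'⟩ := integrableOn_rpow_mul_exp_neg_div hb
  have hle : ∀ s : ℝ, 0 < s → 0 ≤ 1 - exp (-b / s) := fun s hs => by
    rw [sub_nonneg, exp_le_one_iff, neg_div, neg_nonpos]; positivity
  have h0 : Tendsto (fun s => 2 * (√s * (1 - exp (-b / s)))) (nhdsWithin 0 (Set.Ioi 0))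
      (nhds 0) := by
    have : Tendsto (fun s => 2 * √s) (nhdsWithin 0 (Set.Ioi 0)) (nhds 0) := by
      have : Continuous fun s => 2 * √s := by fun_prop
      simpa using (this.tendsto 0).mono_left nhdsWithin_le_nhds
    refine squeeze_zero' ?_ ?_ this
    · filter_upwards [self_mem_nhdsWithin] with s hs
      have := hle s hs
      positivity
    · filter_upwards [self_mem_nhdsWithin] with s hs
      have := exp_pos (-b / s)
      nlinarith [sqrt_nonneg s, mul_nonneg (sqrt_nonneg s) this.le]
  have hinf : Tendsto (fun s => 2 * (√s * (1 - exp (-b / s)))) atTop (nhds 0) := by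
    have : Tendsto (fun s => 2 * b * (√s)⁻¹) atTop (nhds 0) := by
      simpa using (tendsto_sqrt_atTop.inv_tendsto_atTop).const_mul (2 * b)
    refine squeeze_zero' ?_ ?_ this
    · filter_upwards [eventually_gt_atTop 0] with s hs
      have := hle s hs
      positivity
    · filter_upwards [eventually_gt_atTop 0] with s hs
      have h1 := one_sub_exp_neg_div_le b s
      have hq : 0 < √s := sqrt_pos.2 hs
      calc 2 * (√s * (1 - exp (-b / s))) ≤ 2 * (√s * (b / (√s * √s))) := by
            rw [mul_self_sqrt hs.le]; gcongr
        _ = _ := by field_simp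
  have hd : ∀ s ∈ Set.Ioi (0 : ℝ), HasDerivAt (fun s => 2 * (√s * (1 - exp (-b / s)))) _ s :=
    fun s hs => hasDerivAt_sqrt_mul_one_sub_exp (b := b) hs
  have hF : IntegrableOn (fun s : ℝ => s ^ (-1 / 2 : ℝ) * (1 - exp (-b / s))) (Set.Ioi 0) := by
    have hm : Measurable fun s : ℝ => s ^ (-1 / 2 : ℝ) * (1 - exp (-b / s)) := by fun_prop
    rw [← Set.Ioc_union_Ioi_eq_Ioi zero_le_one]
    refine IntegrableOn.union ?_ ?_
    · have : IntegrableOn (fun s : ℝ => s ^ (-1 / 2 : ℝ)) (Set.Ioc 0 1) :=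
        (intervalIntegrable_iff_integrableOn_Ioc_of_le zero_le_one).1
          (intervalIntegral.intervalIntegrable_rpow' (by norm_num))
      refine this.mono' hm.aestronglyMeasurable ?_
      filter_upwards [ae_restrict_mem measurableSet_Ioc] with s hs
      have h1 := hle s hs.1
      have h2 := exp_pos (-b / s)
      have h3 := rpow_nonneg hs.1.le (-1 / 2)
      rw [norm_of_nonneg (by positivity)]
      nlinarith
    · have : IntegrableOn (fun s : ℝ => b * s ^ (-3 / 2 : ℝ)) (Set.Ioi 1) :=
        (integrableOn_Ioi_rpow_of_lt (by norm_num) zero_lt_one).const_mul b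
      refine this.mono' hm.aestronglyMeasurable ?_
      filter_upwards [ae_restrict_mem measurableSet_Ioi] with s hs
      have hs : 0 < s := zero_lt_one.trans hs
      have h1 := hle s hs
      rw [norm_of_nonneg (by positivity)]
      calc s ^ (-1 / 2 : ℝ) * (1 - exp (-b / s)) ≤ s ^ (-1 / 2 : ℝ) * (b / s) := by
            gcongr; exact one_sub_exp_neg_div_le b s
        _ = b * (s ^ (-1 / 2 : ℝ) / s ^ (1 : ℝ)) := by rw [rpow_one]; ring
        _ = _ := by rw [← rpow_sub hs]; norm_num
  refine ⟨hF, ?_⟩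
  have hcont : ContinuousWithinAt (fun s => 2 * (√s * (1 - exp (-b / s)))) (Set.Ici 0) 0 := by
    rw [← continuousWithinAt_Ioi_iff_Ici]
    simpa [ContinuousWithinAt] using h0
  have key := integral_Ioi_of_hasDerivAt_of_tendsto hcont hd (hF.sub (hJ.const_mul (2 * b))) hinf
  rw [integral_sub hF (hJ.const_mul (2 * b)), integral_const_mul, hJ'] at key
  have e : b * √(π / b) = √(π * b) := by
    rw [← sqrt_sq hb.le, ← sqrt_mul (by positivity), sqrt_sq hb.le]
    congr 1; field_simp
  simp only [sqrt_zero, zero_mul, mul_zero, sub_zero] at key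
  rw [← e]
  linarith

/-- The plane wave `e^{2πi⟨ξ, x⟩}`. -/
noncomputable def planeWave (ξ x : E3) : ℂ := Complex.exp (↑(2 * π * inner ℝ ξ x) * Complex.I)

theorem norm_planeWave (ξ x : E3) : ‖planeWave ξ x‖ = 1 := Complex.norm_exp_ofReal_mul_I _

theorem planeWave_add (ξ x z : E3) : planeWave ξ (x + z) = planeWave ξ x * planeWave ξ z := by
  rw [planeWave, planeWave, planeWave, ← Complex.exp_add, inner_add_right]
  push_cast
  ring_nf

theorem planeWave_add_planeWave_neg (ξ z : E3) :
    planeWave ξ z + planeWave ξ (-z) = 2 * (Real.cos (2 * π * inner ℝ ξ z) : ℂ) := by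
  rw [planeWave, planeWave, inner_neg_right, Complex.ofReal_cos, Complex.two_cos]
  push_cast
  ring_nf

theorem re_planeWave (ξ z : E3) : (planeWave ξ z).re = Real.cos (2 * π * inner ℝ ξ z) :=
  Complex.exp_ofReal_mul_I_re _

theorem continuous_planeWave : Continuous fun p : E3 × E3 => planeWave p.1 p.2 := by
  unfold planeWave
  fun_prop

theorem gaussian_planeWave_eq (s : ℝ) (ξ z : E3) :
    ((exp (-(π * s) * ‖z‖ ^ 2) : ℝ) : ℂ) * planeWave ξ z =
      Complex.exp (-((π * s : ℝ) : ℂ) * ‖z‖ ^ 2 + (2 * π * Complex.I) * ↑(inner ℝ ξ z)) := by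
  rw [planeWave, Complex.ofReal_exp, ← Complex.exp_add]
  push_cast
  ring_nf

theorem integrable_gaussian_planeWave {s : ℝ} (hs : 0 < s) (ξ : E3) :
    Integrable fun z => ((exp (-(π * s) * ‖z‖ ^ 2) : ℝ) : ℂ) * planeWave ξ z := by
  simp only [gaussian_planeWave_eq]
  exact GaussianFourier.integrable_cexp_neg_mul_sq_norm_add
    (by rw [Complex.ofReal_re]; positivity) _ _

theorem integral_gaussian_planeWave {s : ℝ} (hs : 0 < s) (ξ : E3) :
    ∫ z, ((exp (-(π * s) * ‖z‖ ^ 2) : ℝ) : ℂ) * planeWave ξ z =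
      ((s ^ (-3 / 2 : ℝ) * exp (-(π * ‖ξ‖ ^ 2) / s) : ℝ) : ℂ) := by
  have hπ := pi_pos
  simp only [gaussian_planeWave_eq]
  rw [GaussianFourier.integral_cexp_neg_mul_sq_norm_add
    (by rw [Complex.ofReal_re]; positivity) _ _, finrank_E3, Complex.ofReal_mul (s ^ _)]
  congr 1
  · have : (π : ℂ) / ((π * s : ℝ) : ℂ) = ((s⁻¹ : ℝ) : ℂ) := by
      rw [← Complex.ofReal_div]
      congr 1
      field_simp
    rw [this, neg_div, rpow_neg hs.le, ← inv_rpow hs.le, Complex.ofReal_cpow (by positivity)]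
    norm_num
  · rw [Complex.ofReal_exp]
    congr 1
    have h1 : (π : ℂ) ≠ 0 := Complex.ofReal_ne_zero.2 hπ.ne'
    have h2 : (s : ℂ) ≠ 0 := Complex.ofReal_ne_zero.2 hs.ne'
    push_cast
    field_simp
    rw [Complex.I_sq]
    ring

theorem integrable_gaussian_E3 {s : ℝ} (hs : 0 < s) :
    Integrable fun z : E3 => exp (-(π * s) * ‖z‖ ^ 2) := by
  have h := (integrable_gaussian_planeWave hs 0).norm
  simpa only [norm_mul, norm_planeWave, mul_one, Complex.norm_real,
    norm_of_nonneg (exp_pos _).le] using h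

theorem integral_gaussian_mul_one_sub_cos {s : ℝ} (hs : 0 < s) (ξ : E3) :
    Integrable (fun z => exp (-(π * s) * ‖z‖ ^ 2) * (1 - Real.cos (2 * π * inner ℝ ξ z))) ∧
    ∫ z, exp (-(π * s) * ‖z‖ ^ 2) * (1 - Real.cos (2 * π * inner ℝ ξ z)) =
      s ^ (-3 / 2 : ℝ) * (1 - exp (-(π * ‖ξ‖ ^ 2) / s)) := by
  have hi := integrable_gaussian_planeWave hs
  have hre : ∀ ξ z, (((exp (-(π * s) * ‖z‖ ^ 2) : ℝ) : ℂ) * planeWave ξ z).re =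
      exp (-(π * s) * ‖z‖ ^ 2) * Real.cos (2 * π * inner ℝ ξ z) := fun ξ z => by
    rw [Complex.re_ofReal_mul, re_planeWave]
  have hc : ∀ ξ : E3, Integrable fun z =>
      exp (-(π * s) * ‖z‖ ^ 2) * Real.cos (2 * π * inner ℝ ξ z) := fun ξ => by
    have := (hi ξ).re
    simpa only [RCLike.re_to_complex, hre] using this
  have hv : ∀ ξ : E3, ∫ z, exp (-(π * s) * ‖z‖ ^ 2) * Real.cos (2 * π * inner ℝ ξ z) =
      s ^ (-3 / 2 : ℝ) * exp (-(π * ‖ξ‖ ^ 2) / s) := fun ξ => by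
    have h1 := Complex.reCLM.integral_comp_comm (hi ξ)
    rw [integral_gaussian_planeWave hs] at h1
    simpa only [Complex.reCLM_apply, hre, Complex.ofReal_re] using h1
  have hi0 := integrable_gaussian_E3 hs
  have hv0 := hv 0
  simp only [inner_zero_left, mul_zero, Real.cos_zero, mul_one, norm_zero, ne_eq,
    OfNat.ofNat_ne_zero, not_false_eq_true, zero_pow, neg_zero, zero_div, exp_zero] at hv0
  simp only [mul_sub, mul_one]
  exact ⟨hi0.sub (hc ξ), by rw [integral_sub hi0 (hc ξ), hv0, hv]⟩

theorem integral_mul_exp_neg_mul_Ioi {c : ℝ} (hc : 0 < c) :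
    ∫ s in Set.Ioi (0 : ℝ), s * exp (-(π * s) * c) = 1 / (π ^ 2 * c ^ 2) := by
  have h := integral_rpow_mul_exp_neg_mul_Ioi (a := 2) (r := π * c) two_pos (by positivity)
  rw [Gamma_two, mul_one, rpow_two] at h
  rw [← mul_pow, ← one_div_pow, ← h]
  refine setIntegral_congr_fun measurableSet_Ioi fun s _ => ?_
  have e : -(π * s) * c = -(π * c * s) := by ring
  norm_num [e]

theorem integral_exp_neg_pi_mul_Ioi {c : ℝ} (hc : 0 < c) :
    ∫ s in Set.Ioi (0 : ℝ), exp (-(π * s) * c) = 1 / (π * c) := by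
  have h := integral_rpow_mul_exp_neg_mul_Ioi (a := 1) (r := π * c) one_pos (by positivity)
  rw [Gamma_one, mul_one, rpow_one] at h
  rw [← h]
  refine setIntegral_congr_fun measurableSet_Ioi fun s _ => ?_
  norm_num
  ring_nf

theorem integral_one_sub_cos_div (ξ : E3) :
    Integrable (fun z : E3 => (1 - Real.cos (2 * π * inner ℝ ξ z)) / ‖z‖ ^ 4) ∧
    ∫ z : E3, (1 - Real.cos (2 * π * inner ℝ ξ z)) / ‖z‖ ^ 4 = 2 * π ^ 3 * ‖ξ‖ := by
  have hπ := pi_pos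
  set K : E3 × ℝ → ℝ := fun p =>
    p.2 * (exp (-(π * p.2) * ‖p.1‖ ^ 2) * (1 - Real.cos (2 * π * inner ℝ ξ p.1))) with hK
  have hcos : ∀ t, 0 ≤ 1 - Real.cos t := fun t => by linarith [Real.cos_le_one t]
  have hKc : Continuous K := by rw [hK]; fun_prop
  obtain ⟨hF, hF'⟩ := integral_rpow_mul_one_sub_exp (b := π * ‖ξ‖ ^ 2) (by positivity)
  have hinner : ∀ s ∈ Set.Ioi (0 : ℝ), ∫ z, K (z, s) =
      s ^ (-1 / 2 : ℝ) * (1 - exp (-(π * ‖ξ‖ ^ 2) / s)) := fun s hs => by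
    have hs' : (0 : ℝ) < s := hs
    rw [integral_const_mul, (integral_gaussian_mul_one_sub_cos hs' ξ).2, ← mul_assoc,
      ← rpow_one_add' hs'.le (by norm_num)]
    norm_num
  have hKi : Integrable K (volume.prod (volume.restrict (Set.Ioi 0))) := by
    rw [integrable_prod_iff' hKc.aestronglyMeasurable]
    constructor
    · filter_upwards [ae_restrict_mem measurableSet_Ioi] with s hs
      exact (integral_gaussian_mul_one_sub_cos hs ξ).1.const_mul s
    · refine (hF.congr_fun (fun s hs => ?_) measurableSet_Ioi : IntegrableOn _ (Set.Ioi (0 : ℝ)))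
      refine (hinner s hs).symm.trans (integral_congr_ae (ae_of_all _ fun z => ?_))
      have hs' : (0 : ℝ) < s := hs
      exact (norm_of_nonneg (mul_nonneg hs'.le (mul_nonneg (exp_pos _).le (hcos _)))).symm
  have houter : ∀ z : E3, ∫ s in Set.Ioi (0 : ℝ), K (z, s) =
      1 / π ^ 2 * ((1 - Real.cos (2 * π * inner ℝ ξ z)) / ‖z‖ ^ 4) := fun z => by
    rcases eq_or_ne z 0 with rfl | hz
    · simp [hK]
    · have : 0 < ‖z‖ ^ 2 := by positivity
      simp only [hK, ← mul_assoc]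
      rw [integral_mul_const, integral_mul_exp_neg_mul_Ioi this]
      field_simp
  have hleft := hKi.integral_prod_left
  have hswap := integral_integral_swap (f := fun z s => K (z, s)) hKi
  simp only [houter] at hleft hswap
  constructor
  · exact (integrable_const_mul_iff (IsUnit.mk0 _ (by positivity)) _).1 hleft
  · rw [setIntegral_congr_fun measurableSet_Ioi hinner, hF', integral_const_mul,
      ← mul_assoc π π, ← sq, ← mul_pow, sqrt_sq (by positivity)] at hswap
    rw [← mul_right_inj' (by positivity : 1 / π ^ 2 ≠ 0), hswap]
    field_simp

theorem exists_fourier_representation (φ : SchwartzMap E3 ℝ) :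
    ∃ g : E3 → ℂ, Continuous g ∧ Integrable g ∧ Integrable (fun ξ => (‖ξ‖ : ℂ) * g ξ) ∧
      ∀ x, (φ x : ℂ) = ∫ ξ, g ξ * planeWave ξ x := by
  set ψ : SchwartzMap E3 ℂ := SchwartzMap.postcompCLM Complex.ofRealCLM φ with hψ
  set g : SchwartzMap E3 ℂ := FourierTransform.fourier ψ with hg
  refine ⟨g, g.continuous, g.integrable, ?_, fun x => ?_⟩
  · have h := g.integrable_pow_mul volume 1
    have := g.continuous
    refine h.mono (Continuous.aestronglyMeasurable (by fun_prop)) (ae_of_all _ fun ξ => ?_)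
    simp
  · have h1 : (φ x : ℂ) = ψ x := rfl
    have h2 : ψ = FourierTransformInv.fourierInv g :=
      (FourierPair.fourierInv_fourier_eq ψ).symm
    rw [h1, h2, SchwartzMap.fourierInv_coe, Real.fourierInv_eq']
    refine integral_congr_ae (ae_of_all _ fun ξ => ?_)
    simp only [smul_eq_mul, planeWave, mul_comm]

theorem Integrable.mul_planeWave {g : E3 → ℂ} (hg : Integrable g) (x : E3) :
    Integrable fun ξ => g ξ * planeWave ξ x := by
  have := continuous_planeWave
  refine hg.mono (hg.aestronglyMeasurable.mul
    (Continuous.aestronglyMeasurable (by fun_prop))) (ae_of_all _ fun ξ => ?_)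
  rw [norm_mul, norm_planeWave, mul_one]

theorem secondDiff_eq_integral {φ : E3 → ℝ} {g : E3 → ℂ} (hg : Integrable g)
    (h : ∀ x, (φ x : ℂ) = ∫ ξ, g ξ * planeWave ξ x) (x z : E3) :
    (secondDiff φ x z : ℂ) =
      2 * ∫ ξ, g ξ * planeWave ξ x * ((1 - Real.cos (2 * π * inner ℝ ξ z) : ℝ) : ℂ) := by
  have hi := Integrable.mul_planeWave hg
  rw [secondDiff, Complex.ofReal_sub, Complex.ofReal_sub, Complex.ofReal_mul, h, h, h,
    ← integral_const_mul, ← integral_const_mul, ← integral_sub' ((hi x).const_mul _) (hi _),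
    ← integral_sub' (((hi x).const_mul _).sub (hi _)) (hi _)]
  refine integral_congr_ae (ae_of_all _ fun ξ => ?_)
  have e := planeWave_add_planeWave_neg ξ z
  simp only [Pi.sub_apply]
  rw [sub_eq_add_neg x z, planeWave_add, planeWave_add, Complex.ofReal_sub, Complex.ofReal_one,
    Complex.ofReal_ofNat]
  linear_combination (-(g ξ * planeWave ξ x)) * e

theorem halfLap_eq_integral (φ : SchwartzMap E3 ℝ) {g : E3 → ℂ} (hgc : Continuous g)
    (hg : Integrable g) (hg1 : Integrable (fun ξ => (‖ξ‖ : ℂ) * g ξ))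
    (h : ∀ x, (φ x : ℂ) = ∫ ξ, g ξ * planeWave ξ x) (x : E3) :
    (halfLap φ x : ℂ) = ∫ ξ, 2 * π * ((‖ξ‖ : ℂ) * g ξ) * planeWave ξ x := by
  have hπ := pi_pos
  set c : E3 → E3 → ℝ := fun ξ z => (1 - Real.cos (2 * π * inner ℝ ξ z)) / ‖z‖ ^ 4 with hc
  have hc0 : ∀ ξ z, 0 ≤ c ξ z := fun ξ z => by
    have := Real.cos_le_one (2 * π * inner ℝ ξ z)
    have : 0 ≤ 1 - Real.cos (2 * π * inner ℝ ξ z) := by linarith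
    positivity
  have hcm : Measurable fun p : E3 × E3 => c p.1 p.2 := by
    refine Measurable.div ?_ (by fun_prop)
    exact Continuous.measurable (by fun_prop)
  have hpw := continuous_planeWave
  have hint : Integrable (Function.uncurry fun ξ z => g ξ * planeWave ξ x * (c ξ z : ℂ))
      (volume.prod volume) := by
    rw [integrable_prod_iff]
    · refine ⟨ae_of_all _ fun ξ => ?_, ?_⟩
      · exact ((integral_one_sub_cos_div ξ).1.ofReal (𝕜 := ℂ)).const_mul (g ξ * planeWave ξ x)
      · refine (hg1.norm.const_mul (2 * π ^ 3)).congr (ae_of_all _ fun ξ => ?_)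
        simp only [Function.uncurry_apply_pair, norm_mul, norm_planeWave, mul_one,
          Complex.norm_real, norm_norm, norm_of_nonneg (hc0 _ _)]
        rw [integral_const_mul, (integral_one_sub_cos_div ξ).2]
        ring
    · refine AEStronglyMeasurable.mul ?_ ?_
      · exact Continuous.aestronglyMeasurable (by fun_prop)
      · exact (Complex.measurable_ofReal.comp hcm).aestronglyMeasurable
  have hswap := integral_integral_swap hint
  have e1 : ∀ ξ, ∫ z, g ξ * planeWave ξ x * (c ξ z : ℂ) =
      π ^ 2 * (2 * π * ((‖ξ‖ : ℂ) * g ξ) * planeWave ξ x) := fun ξ => by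
    rw [integral_const_mul, integral_complex_ofReal, (integral_one_sub_cos_div ξ).2]
    push_cast
    ring
  have e2 : ∀ z, ∫ ξ, g ξ * planeWave ξ x * (c ξ z : ℂ) =
      ((secondDiff φ x z / ‖z‖ ^ 4 : ℝ) : ℂ) / 2 := fun z => by
    rw [Complex.ofReal_div, secondDiff_eq_integral hg h, mul_div_assoc, mul_div_cancel_left₀ _
      two_ne_zero, ← integral_div]
    refine integral_congr_ae (ae_of_all _ fun ξ => ?_)
    simp only [hc]
    push_cast
    ring
  simp only [e1, e2] at hswap
  rw [integral_const_mul, integral_div, integral_complex_ofReal] at hswap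
  rw [halfLap_eq, Complex.ofReal_mul]
  have hπ2 : (π : ℂ) ^ 2 ≠ 0 := pow_ne_zero _ (Complex.ofReal_ne_zero.2 hπ.ne')
  rw [← mul_right_inj' hπ2, hswap]
  push_cast
  field_simp

theorem inv_norm_sq_mul_le (x y : E3) :
    1 / (1 + ‖x‖) ^ 4 * (1 / ‖x - y‖ ^ 2) ≤
      (Metric.ball (0 : E3) 1).indicator (fun z => 1 / ‖z‖ ^ 2) (x - y) + 1 / (1 + ‖x‖) ^ 4 := by
  have h0 : 1 / (1 + ‖x‖) ^ 4 ≤ 1 := by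
    rw [div_le_one₀ (by positivity)]
    exact one_le_pow₀ (by linarith [norm_nonneg x])
  have h1 : 0 ≤ 1 / (1 + ‖x‖) ^ 4 := by positivity
  have h2 : 0 ≤ 1 / ‖x - y‖ ^ 2 := by positivity
  by_cases h : ‖x - y‖ < 1
  · rw [Set.indicator_of_mem (by simpa using h)]
    nlinarith
  · rw [Set.indicator_of_notMem (by simpa using h), zero_add]
    push Not at h
    have : 1 / ‖x - y‖ ^ 2 ≤ 1 := by
      rw [div_le_one₀ (by positivity)]
      exact one_le_pow₀ h
    nlinarith

theorem integrable_inv_norm_sq_mul (y : E3) :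
    Integrable (fun x => 1 / (1 + ‖x‖) ^ 4 * (1 / ‖x - y‖ ^ 2)) ∧
    ∫ x, 1 / (1 + ‖x‖) ^ 4 * (1 / ‖x - y‖ ^ 2) ≤
      (∫ z, (Metric.ball (0 : E3) 1).indicator (fun z => 1 / ‖z‖ ^ 2) z) +
        ∫ x : E3, 1 / (1 + ‖x‖) ^ 4 := by
  have i1 := integrable_indicator_ball_inv_norm_sq.comp_sub_right y
  have i2 := integrable_inv_one_add_norm_pow_four
  have hi : Integrable (fun x => 1 / (1 + ‖x‖) ^ 4 * (1 / ‖x - y‖ ^ 2)) := by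
    refine (i1.add i2).mono' (Measurable.aestronglyMeasurable (by fun_prop))
      (ae_of_all _ fun x => ?_)
    rw [norm_of_nonneg (by positivity)]
    exact inv_norm_sq_mul_le x y
  refine ⟨hi, (integral_mono hi (i1.add i2) fun x => inv_norm_sq_mul_le x y).trans (le_of_eq ?_)⟩
  rw [integral_add' i1 i2, integral_sub_right_eq_self
    (fun z => (Metric.ball (0 : E3) 1).indicator (fun z => 1 / ‖z‖ ^ 2) z) y]

theorem integrable_mul_inv_norm_sq {w : E3 → ℝ} {C : ℝ} (hw : StronglyMeasurable w)
    (hb : ∀ x, |w x| ≤ C * (1 / (1 + ‖x‖) ^ 4)) (y : E3) :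
    Integrable fun x => w x * (1 / ‖x - y‖ ^ 2) := by
  refine ((integrable_inv_norm_sq_mul y).1.const_mul C).mono' (hw.aestronglyMeasurable.mul
    (Measurable.aestronglyMeasurable (by fun_prop))) (ae_of_all _ fun x => ?_)
  rw [norm_mul, norm_of_nonneg (by positivity : 0 ≤ 1 / ‖x - y‖ ^ 2), ← mul_assoc]
  gcongr
  exact hb x

theorem integrable_prod_mul_inv_norm_sq {f w : E3 → ℝ} {C : ℝ} (hf : Continuous f)
    (hfi : Integrable f) (hC : 0 ≤ C) (hw : StronglyMeasurable w)
    (hb : ∀ x, |w x| ≤ C * (1 / (1 + ‖x‖) ^ 4)) :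
    Integrable (Function.uncurry fun x y : E3 => f y * (w x * (1 / ‖x - y‖ ^ 2)))
      (volume.prod volume) := by
  have hm : AEStronglyMeasurable (Function.uncurry fun x y : E3 =>
      f y * (w x * (1 / ‖x - y‖ ^ 2))) (volume.prod volume) := by
    refine AEStronglyMeasurable.mul ?_ (AEStronglyMeasurable.mul ?_ ?_)
    · exact Continuous.aestronglyMeasurable (by fun_prop)
    · exact (hw.comp_measurable measurable_fst).aestronglyMeasurable
    · exact Measurable.aestronglyMeasurable (by fun_prop)
  rw [integrable_prod_iff' hm]
  refine ⟨ae_of_all _ fun y => (integrable_mul_inv_norm_sq hw hb y).const_mul (f y), ?_⟩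
  set A := (∫ z, (Metric.ball (0 : E3) 1).indicator (fun z => 1 / ‖z‖ ^ 2) z) +
        ∫ x : E3, 1 / (1 + ‖x‖) ^ 4
  refine (hfi.norm.mul_const (C * A)).mono' hm.norm.prod_swap.integral_prod_right'
    (ae_of_all _ fun y => ?_)
  rw [norm_of_nonneg (integral_nonneg fun x => norm_nonneg _)]
  simp only [Function.uncurry_apply_pair, norm_mul (f y)]
  rw [integral_const_mul]
  gcongr
  calc ∫ x, ‖w x * (1 / ‖x - y‖ ^ 2)‖
      ≤ ∫ x, C * (1 / (1 + ‖x‖) ^ 4 * (1 / ‖x - y‖ ^ 2)) := by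
        refine integral_mono (integrable_mul_inv_norm_sq hw hb y).norm
          ((integrable_inv_norm_sq_mul y).1.const_mul C) fun x => ?_
        simp only
        rw [norm_mul, norm_of_nonneg (by positivity : 0 ≤ 1 / ‖x - y‖ ^ 2), ← mul_assoc]
        gcongr
        exact hb x
    _ ≤ C * A := by
        rw [integral_const_mul]
        gcongr
        exact (integrable_inv_norm_sq_mul y).2

theorem integral_gaussian_sub_mul_planeWave {s : ℝ} (hs : 0 < s) (ξ y : E3) :
    ∫ x, ((exp (-(π * s) * ‖x - y‖ ^ 2) : ℝ) : ℂ) * planeWave ξ x =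
      ((s ^ (-3 / 2 : ℝ) * exp (-(π * ‖ξ‖ ^ 2) / s) : ℝ) : ℂ) * planeWave ξ y := by
  rw [← integral_gaussian_planeWave hs, ← integral_mul_const, ← integral_add_right_eq_self _ y]
  refine integral_congr_ae (ae_of_all _ fun x => ?_)
  simp only [add_sub_cancel_right, planeWave_add]
  ring

theorem integral_gaussian_mul_fourier {s : ℝ} (hs : 0 < s) {m : E3 → ℂ} (hmc : Continuous m)
    (hm : Integrable m) (y : E3) :
    ∫ x, ((exp (-(π * s) * ‖x - y‖ ^ 2) : ℝ) : ℂ) * ∫ ξ, m ξ * planeWave ξ x =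
      ∫ ξ, ((s ^ (-3 / 2 : ℝ) * exp (-(π * ‖ξ‖ ^ 2) / s) : ℝ) : ℂ) *
        (m ξ * planeWave ξ y) := by
  have hpw := continuous_planeWave
  have hint : Integrable (Function.uncurry fun x ξ : E3 =>
      ((exp (-(π * s) * ‖x - y‖ ^ 2) : ℝ) : ℂ) * (m ξ * planeWave ξ x))
      (volume.prod volume) := by
    have h1 := ((integrable_gaussian_E3 hs).comp_sub_right y).mul_prod hm.norm
    refine h1.mono (Continuous.aestronglyMeasurable (by fun_prop)) (ae_of_all _ fun p => ?_)
    simp only [Function.uncurry, norm_mul, norm_planeWave, mul_one, Complex.norm_real, norm_norm,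
      le_refl]
  have hswap := integral_integral_swap hint
  simp only [integral_const_mul] at hswap
  rw [hswap]
  refine integral_congr_ae (ae_of_all _ fun ξ => ?_)
  simp only
  rw [mul_left_comm, ← integral_gaussian_sub_mul_planeWave hs, ← integral_const_mul]
  refine integral_congr_ae (ae_of_all _ fun x => ?_)
  simp only
  ring

theorem integral_halfLap_mul_inv_norm_sq_eq_Ioi (φ : SchwartzMap E3 ℝ) (y : E3) :
    ∫ x, halfLap φ x * (1 / ‖x - y‖ ^ 2) =
      π * ∫ s in Set.Ioi (0 : ℝ), ∫ x, exp (-(π * s) * ‖x - y‖ ^ 2) * halfLap φ x := by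
  have hπ := pi_pos
  obtain ⟨C, hC, hb⟩ := exists_halfLap_bound φ
  have hw := stronglyMeasurable_halfLap φ
  have hpot := integrable_mul_inv_norm_sq hw hb y
  have hne : ∀ᵐ x : E3, x ≠ y := by simp [ae_iff, measure_singleton]
  have hval : ∀ x, x ≠ y → ∀ c : ℝ, ∫ s in Set.Ioi (0 : ℝ), exp (-(π * s) * ‖x - y‖ ^ 2) * c =
      1 / π * (c * (1 / ‖x - y‖ ^ 2)) := fun x hx c => by
    have : 0 < ‖x - y‖ ^ 2 := by
      have := norm_pos_iff.2 (sub_ne_zero.2 hx)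
      positivity
    rw [integral_mul_const, integral_exp_neg_pi_mul_Ioi this]
    field_simp
  have hint : Integrable (Function.uncurry fun (x : E3) (s : ℝ) =>
      exp (-(π * s) * ‖x - y‖ ^ 2) * halfLap φ x)
      (volume.prod (volume.restrict (Set.Ioi 0))) := by
    rw [integrable_prod_iff]
    · constructor
      · filter_upwards [hne] with x hx
        have h1 : -(π * ‖x - y‖ ^ 2) < 0 := by
          have := norm_pos_iff.2 (sub_ne_zero.2 hx)
          rw [neg_neg_iff_pos]
          positivity
        have h2 := (integrableOn_exp_mul_Ioi h1 0).mul_const (halfLap φ x)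
        refine h2.congr (ae_of_all _ fun s => ?_)
        simp only [Function.uncurry_apply_pair]
        ring_nf
      · refine (hpot.norm.const_mul (1 / π)).congr ?_
        filter_upwards [hne] with x hx
        simp only [Function.uncurry_apply_pair, norm_mul, norm_of_nonneg (exp_pos _).le]
        rw [hval x hx, norm_of_nonneg (by positivity : 0 ≤ 1 / ‖x - y‖ ^ 2)]
    · refine AEStronglyMeasurable.mul ?_ ?_
      · exact Continuous.aestronglyMeasurable (by fun_prop)
      · exact (hw.comp_measurable measurable_fst).aestronglyMeasurable
  rw [← integral_integral_swap hint, ← integral_const_mul]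
  refine integral_congr_ae ?_
  filter_upwards [hne] with x hx
  rw [hval x hx]
  field_simp

/-- The Riesz potential of order two inverts the half Laplacian up to a Fourier multiplier. -/
theorem integral_halfLap_mul_inv_norm_sq (φ : SchwartzMap E3 ℝ) (y : E3) :
    ∫ x, halfLap φ x * (1 / ‖x - y‖ ^ 2) = 2 * π ^ 2 * φ y := by
  have hπ := pi_pos
  obtain ⟨g, hgc, hg, hg1, h⟩ := exists_fourier_representation φ
  set m : E3 → ℂ := fun ξ => 2 * π * ((‖ξ‖ : ℂ) * g ξ) with hm
  have hmc : Continuous m := by rw [hm]; fun_prop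
  have hmi : Integrable m := hg1.const_mul _
  have hne : ∀ᵐ ξ : E3, ξ ≠ 0 := by simp [ae_iff, measure_singleton]
  have hpw := continuous_planeWave
  have hJ : ∀ ξ : E3, ξ ≠ 0 →
      IntegrableOn (fun s : ℝ => s ^ (-3 / 2 : ℝ) * exp (-(π * ‖ξ‖ ^ 2) / s)) (Set.Ioi 0) ∧
      ∫ s in Set.Ioi (0 : ℝ), s ^ (-3 / 2 : ℝ) * exp (-(π * ‖ξ‖ ^ 2) / s) = 1 / ‖ξ‖ :=
    fun ξ hξ => by
      have hξ' := norm_pos_iff.2 hξ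
      have := integrableOn_rpow_mul_exp_neg_div (b := π * ‖ξ‖ ^ 2) (by positivity)
      refine ⟨this.1, this.2.trans ?_⟩
      rw [div_mul_cancel_left₀ hπ.ne', ← inv_pow, sqrt_sq (by positivity), one_div]
  have hint : Integrable (Function.uncurry fun (ξ : E3) (s : ℝ) =>
      ((s ^ (-3 / 2 : ℝ) * exp (-(π * ‖ξ‖ ^ 2) / s) : ℝ) : ℂ) * (m ξ * planeWave ξ y))
      (volume.prod (volume.restrict (Set.Ioi 0))) := by
    rw [integrable_prod_iff]
    · constructor
      · filter_upwards [hne] with ξ hξ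
        exact ((hJ ξ hξ).1.ofReal (𝕜 := ℂ)).mul_const (m ξ * planeWave ξ y)
      · refine (hg.norm.const_mul (2 * π)).congr ?_
        filter_upwards [hne] with ξ hξ
        have hξ' := norm_pos_iff.2 hξ
        simp only [Function.uncurry_apply_pair]
        have e : ∀ s ∈ Set.Ioi (0 : ℝ),
            ‖((s ^ (-3 / 2 : ℝ) * exp (-(π * ‖ξ‖ ^ 2) / s) : ℝ) : ℂ) * (m ξ * planeWave ξ y)‖ =
            s ^ (-3 / 2 : ℝ) * exp (-(π * ‖ξ‖ ^ 2) / s) * ‖m ξ‖ := fun s hs => by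
          have hs' : (0 : ℝ) < s := hs
          rw [norm_mul, norm_mul, norm_planeWave, mul_one, Complex.norm_real,
            norm_of_nonneg (by positivity)]
        rw [setIntegral_congr_fun measurableSet_Ioi e, integral_mul_const, (hJ ξ hξ).2]
        simp only [hm, norm_mul, Complex.norm_real, norm_norm, Complex.norm_ofNat,
          norm_of_nonneg hπ.le]
        field_simp
    · refine AEStronglyMeasurable.mul ?_ ?_
      · refine (Complex.measurable_ofReal.comp ?_).aestronglyMeasurable
        fun_prop
      · exact Continuous.aestronglyMeasurable (by fun_prop)
  have hmain : ((∫ s in Set.Ioi (0 : ℝ), ∫ x, exp (-(π * s) * ‖x - y‖ ^ 2) * halfLap φ x : ℝ) : ℂ)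
      = 2 * π * φ y := by
    rw [← integral_complex_ofReal]
    have e : ∀ s ∈ Set.Ioi (0 : ℝ),
        ((∫ x, exp (-(π * s) * ‖x - y‖ ^ 2) * halfLap φ x : ℝ) : ℂ) =
        ∫ ξ, ((s ^ (-3 / 2 : ℝ) * exp (-(π * ‖ξ‖ ^ 2) / s) : ℝ) : ℂ) *
          (m ξ * planeWave ξ y) := fun s hs => by
      rw [← integral_gaussian_mul_fourier hs hmc hmi, ← integral_complex_ofReal]
      refine integral_congr_ae (ae_of_all _ fun x => ?_)
      simp only [hm]
      rw [Complex.ofReal_mul, halfLap_eq_integral φ hgc hg hg1 h]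
    rw [setIntegral_congr_fun measurableSet_Ioi e, ← integral_integral_swap hint, h,
      ← integral_const_mul]
    refine integral_congr_ae ?_
    filter_upwards [hne] with ξ hξ
    have hξ' : (‖ξ‖ : ℂ) ≠ 0 := Complex.ofReal_ne_zero.2 (norm_ne_zero_iff.2 hξ)
    rw [integral_mul_const, integral_complex_ofReal, (hJ ξ hξ).2]
    simp only [hm]
    push_cast
    field_simp
  have hmain' : ∫ s in Set.Ioi (0 : ℝ), ∫ x, exp (-(π * s) * ‖x - y‖ ^ 2) * halfLap φ x =
      2 * π * φ y := by exact_mod_cast hmain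
  rw [integral_halfLap_mul_inv_norm_sq_eq_Ioi, hmain']
  ring

theorem neg_lap_solV {u : E3 → ℝ} (hc : Continuous fun y => exp (3 * u y))
    (hi : Integrable fun y => exp (3 * u y)) (x : E3) :
    -(lap (solV u) x) = (1 / π ^ 2) * ∫ y, exp (3 * u y) / ‖x - y‖ ^ 2 := by
  rw [solV_eq_log_potential, lap_const_mul, lap_log_potential hc hi]
  ring

theorem continuous_inv_norm_sq_potential {f : E3 → ℝ} (hf : Continuous f) (hfi : Integrable f) :
    Continuous fun x => ∫ y, f y / ‖x - y‖ ^ 2 := by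
  have h := continuous_potential (k := fun z : E3 => 1 / ‖z‖ ^ 2) hf hfi
    (ContinuousOn.div continuousOn_const (by fun_prop) fun z hz => by
      have : ‖z‖ ≠ 0 := by simpa using hz
      positivity) zero_le_one fun z => by
        rw [norm_of_nonneg (by positivity)]
        linarith
  simpa only [smul_eq_mul, mul_one_div] using h

theorem memL12_inv_norm_sq_potential {f : E3 → ℝ} (hf : Continuous f) (hfi : Integrable f) :
    MemL12 fun x => ∫ y, f y / ‖x - y‖ ^ 2 := by
  have hcont := continuous_inv_norm_sq_potential hf hfi
  refine ⟨hcont.locallyIntegrable, ?_⟩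
  have hw : StronglyMeasurable fun x : E3 => 1 / (1 + ‖x‖) ^ 4 :=
    Measurable.stronglyMeasurable (by fun_prop)
  have h := (integrable_prod_mul_inv_norm_sq (C := 1) hf hfi zero_le_one hw fun x => by
    rw [one_mul, abs_of_nonneg (by positivity)]).integral_prod_left
  have e : ∀ x : E3, ∫ y, Function.uncurry
      (fun x y : E3 => f y * (1 / (1 + ‖x‖) ^ 4 * (1 / ‖x - y‖ ^ 2))) (x, y) =
      1 / (1 + ‖x‖) ^ 4 * ∫ y, f y / ‖x - y‖ ^ 2 := fun x => by
    rw [← integral_const_mul]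
    refine integral_congr_ae (ae_of_all _ fun y => ?_)
    simp only [Function.uncurry_apply_pair]
    ring
  simp only [e] at h
  refine (h.norm.const_mul 8).mono' ?_ (ae_of_all _ fun x => ?_)
  · refine Continuous.aestronglyMeasurable (Continuous.div (by fun_prop) (by fun_prop) fun x => ?_)
    positivity
  · have h1 : (1 + ‖x‖) ^ 4 ≤ 8 * (1 + ‖x‖ ^ 4) := by
      nlinarith [sq_nonneg (‖x‖ - 1), sq_nonneg (‖x‖ ^ 2 - 1), sq_nonneg (‖x‖ ^ 2 - ‖x‖),
        sq_nonneg (‖x‖ ^ 2 + ‖x‖ - 2)]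
    rw [norm_mul, norm_div, norm_of_nonneg (by positivity : 0 ≤ 1 / (1 + ‖x‖) ^ 4),
      norm_of_nonneg (by positivity : 0 ≤ 1 + ‖x‖ ^ 4), norm_eq_abs, norm_eq_abs, abs_abs,
      div_eq_mul_one_div, mul_comm, ← mul_assoc]
    gcongr
    rw [mul_one_div, div_le_div_iff₀ (by positivity) (by positivity)]
    linarith

theorem integral_potential_mul_halfLap {f : E3 → ℝ} (hf : Continuous f) (hfi : Integrable f)
    (φ : SchwartzMap E3 ℝ) :
    ∫ x, (∫ y, f y / ‖x - y‖ ^ 2) * halfLap φ x = 2 * π ^ 2 * ∫ y, f y * φ y := by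
  obtain ⟨C, hC, hb⟩ := exists_halfLap_bound φ
  have hswap := integral_integral_swap
    (integrable_prod_mul_inv_norm_sq hf hfi hC (stronglyMeasurable_halfLap φ) hb)
  simp only [integral_const_mul, integral_halfLap_mul_inv_norm_sq] at hswap
  rw [← integral_const_mul]
  refine Eq.trans ?_ (hswap.trans ?_)
  · refine integral_congr_ae (ae_of_all _ fun x => ?_)
    simp only
    rw [← integral_mul_const]
    refine integral_congr_ae (ae_of_all _ fun y => ?_)
    simp only
    ring
  · refine integral_congr_ae (ae_of_all _ fun y => ?_)
    simp only
    ring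

/-- Theorem 8: for a smooth finite-volume solution `u` of `(−Δ)^{3/2}u = 2e^{3u}`, the
function `v` is `C²` with `−Δv(x) = (1/π²)∫ e^{3u(y)}/|x−y|² dy`, `Δv ∈ L_{1/2}(ℝ³)`, and
`(−Δ)^{3/2}v = (−Δ)^{3/2}u = 2e^{3u}` in the distributional sense. -/
theorem v_solves_same_equation (u : E3 → ℝ) (hu : IsSolution u) :
    ContDiff ℝ 2 (solV u) ∧
    (∀ x : E3, -(lap (solV u) x) = (1 / Real.pi ^ 2) * ∫ y, Real.exp (3 * u y) / ‖x - y‖ ^ 2) ∧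
    MemL12 (lap (solV u)) ∧
    ∀ φ : SchwartzMap E3 ℝ,
      (∫ x, (-(lap (solV u) x)) * halfLap φ x = 2 * ∫ x, Real.exp (3 * u x) * φ x) ∧
      (∫ x, (-(lap (solV u) x)) * halfLap φ x = ∫ x, (-(lap u x)) * halfLap φ x) := by
  obtain ⟨hsm, -, hi, hweak⟩ := hu
  have hc : Continuous fun y => exp (3 * u y) := by
    have := hsm.continuous
    fun_prop
  have hlap := neg_lap_solV hc hi
  have hV : ∀ φ : SchwartzMap E3 ℝ,
      ∫ x, (-(lap (solV u) x)) * halfLap φ x = 2 * ∫ x, exp (3 * u x) * φ x := fun φ => by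
    simp only [hlap, mul_assoc (1 / π ^ 2)]
    rw [integral_const_mul, integral_potential_mul_halfLap hc hi]
    field_simp
  refine ⟨?_, hlap, ?_, fun φ => ⟨hV φ, (hV φ).trans (hweak φ).symm⟩⟩
  · rw [solV_eq_log_potential]
    exact contDiff_const.mul (contDiff_two_log_potential hc hi)
  · obtain ⟨h1, h2⟩ := memL12_inv_norm_sq_potential hc hi
    have e : lap (solV u) = fun x => -(1 / π ^ 2) * ∫ y, exp (3 * u y) / ‖x - y‖ ^ 2 := by
      ext x
      rw [neg_mul, ← hlap, neg_neg]
    rw [e]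
    refine ⟨h1.smul (-(1 / π ^ 2)), (h2.const_mul (1 / π ^ 2)).congr (ae_of_all _ fun x => ?_)⟩
    simp only
    rw [abs_mul, abs_neg, abs_of_nonneg (by positivity : 0 ≤ 1 / π ^ 2), mul_div_assoc]
end

section
/- Let w ∈ L_{1/2}(ℝ³) satisfy ∫_{ℝ³} w(x)·((−Δ)^{1/2}φ)(x) dx = 0 for every Schwartz function φ : ℝ³ → ℝ (i.e. (−Δ)^{1/2}w = 0 in ℝ³ in the sense of tempered distributions). Then w is almost everywhere equal to a constant. -/
open MeasureTheory Real Filter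

open scoped RealInnerProductSpace

/-- The integral defining the Fourier symbol of the half Laplacian, up to the factor `1 / π ^ 2`. -/
noncomputable def halfLapSymbol (ξ : E3) : ℝ := ∫ z : E3, (1 - cos (2 * π * ⟪z, ξ⟫)) / ‖z‖ ^ 4

lemma one_sub_cos_nonneg (t : ℝ) : 0 ≤ 1 - cos t := sub_nonneg.2 (cos_le_one t)

lemma integrable_inv_norm_sq_mul_one_add_norm_sq :
    Integrable (fun z : E3 => (‖z‖ ^ 2 * (1 + ‖z‖ ^ 2))⁻¹) := by
  rw [integrable_fun_norm_addHaar volume (f := fun r : ℝ => (r ^ 2 * (1 + r ^ 2))⁻¹)]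
  refine (integrable_inv_one_add_sq.integrableOn (s := Set.Ioi (0 : ℝ))).congr_fun ?_
    measurableSet_Ioi
  intro r hr
  have hr' : r ≠ 0 := (Set.mem_Ioi.1 hr).ne'
  have : 1 + r ^ 2 ≠ 0 := by positivity
  simp only [finrank_euclideanSpace, Fintype.card_fin, smul_eq_mul]
  field_simp

lemma one_sub_cos_div_le (ξ z : E3) :
    (1 - cos (2 * π * ⟪z, ξ⟫)) / ‖z‖ ^ 4
      ≤ (2 + 2 * π ^ 2 * ‖ξ‖ ^ 2) * (‖z‖ ^ 2 * (1 + ‖z‖ ^ 2))⁻¹ := by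
  rcases eq_or_ne z 0 with rfl | hz
  · simp
  have hz' : 0 < ‖z‖ := norm_pos_iff.2 hz
  have h1 : 1 - cos (2 * π * ⟪z, ξ⟫) ≤ 2 := by linarith [neg_one_le_cos (2 * π * ⟪z, ξ⟫)]
  have h2 : 1 - cos (2 * π * ⟪z, ξ⟫) ≤ 2 * π ^ 2 * ‖ξ‖ ^ 2 * ‖z‖ ^ 2 := by
    have h3 := one_sub_sq_div_two_le_cos (x := 2 * π * ⟪z, ξ⟫)
    have h4 : ⟪z, ξ⟫ ^ 2 ≤ (‖z‖ * ‖ξ‖) ^ 2 := sq_le_sq' (by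
      linarith [neg_le_of_abs_le (abs_real_inner_le_norm z ξ)]) (real_inner_le_norm z ξ)
    have h5 := mul_le_mul_of_nonneg_left h4 (by positivity : 0 ≤ 2 * π ^ 2)
    linarith
  rw [← div_eq_mul_inv, div_le_div_iff₀ (by positivity) (by positivity)]
  have h6 : (1 - cos (2 * π * ⟪z, ξ⟫)) * (1 + ‖z‖ ^ 2)
      ≤ (2 + 2 * π ^ 2 * ‖ξ‖ ^ 2) * ‖z‖ ^ 2 := by
    linarith [mul_le_mul_of_nonneg_right h1 (sq_nonneg ‖z‖)]
  calc _ = (1 - cos (2 * π * ⟪z, ξ⟫)) * (1 + ‖z‖ ^ 2) * ‖z‖ ^ 2 := by ring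
    _ ≤ (2 + 2 * π ^ 2 * ‖ξ‖ ^ 2) * ‖z‖ ^ 2 * ‖z‖ ^ 2 := by gcongr
    _ = _ := by ring

lemma integrable_one_sub_cos_div (ξ : E3) :
    Integrable (fun z : E3 => (1 - cos (2 * π * ⟪z, ξ⟫)) / ‖z‖ ^ 4) := by
  refine (integrable_inv_norm_sq_mul_one_add_norm_sq.const_mul
    (2 + 2 * π ^ 2 * ‖ξ‖ ^ 2)).mono' ?_ (Eventually.of_forall fun z => ?_)
  · exact Measurable.aestronglyMeasurable (by fun_prop)
  · rw [norm_of_nonneg (div_nonneg (one_sub_cos_nonneg _) (by positivity))]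
    exact one_sub_cos_div_le ξ z

lemma halfLapSymbol_nonneg (ξ : E3) : 0 ≤ halfLapSymbol ξ :=
  integral_nonneg fun _ => div_nonneg (one_sub_cos_nonneg _) (by positivity)

lemma halfLapSymbol_eq_of_norm_eq {ξ ζ : E3} (h : ‖ξ‖ = ‖ζ‖) :
    halfLapSymbol ξ = halfLapSymbol ζ := by
  set T := (ℝ ∙ (ξ - ζ))ᗮ.reflection with hT
  have hTξ : T ξ = ζ := Submodule.reflection_sub h
  symm
  rw [halfLapSymbol, halfLapSymbol, ← T.measurePreserving.integral_comp
    T.toHomeomorph.measurableEmbedding]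
  congr 1 with z
  rw [← hTξ, T.inner_map_map, T.norm_map]

lemma halfLapSymbol_smul {r : ℝ} (hr : 0 < r) (ξ : E3) :
    halfLapSymbol (r • ξ) = r * halfLapSymbol ξ := by
  have h := Measure.integral_comp_smul volume
    (fun z : E3 => (1 - cos (2 * π * ⟪z, ξ⟫)) / ‖z‖ ^ 4) r
  have h2 : halfLapSymbol (r • ξ)
      = r ^ 4 * ∫ z : E3, (1 - cos (2 * π * ⟪r • z, ξ⟫)) / ‖r • z‖ ^ 4 := by
    rw [halfLapSymbol, ← integral_const_mul]
    congr 1 with z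
    rw [real_inner_smul_left, real_inner_smul_right, norm_smul, norm_of_nonneg hr.le, mul_pow,
      ← mul_div_assoc, mul_div_mul_left _ _ (by positivity)]
  rw [h2, h, halfLapSymbol, finrank_euclideanSpace, Fintype.card_fin, smul_eq_mul,
    abs_of_pos (by positivity)]
  field_simp

lemma halfLapSymbol_pos {ξ : E3} (hξ : ξ ≠ 0) : 0 < halfLapSymbol ξ := by
  have hn : 0 < ‖ξ‖ := norm_pos_iff.2 hξ
  rw [halfLapSymbol, integral_pos_iff_support_of_nonneg
    (fun _ => div_nonneg (one_sub_cos_nonneg _) (by positivity)) (integrable_one_sub_cos_div ξ)]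
  set U : Set E3 := {z | z ≠ 0} ∩ {z | cos (2 * π * ⟪z, ξ⟫) < 1} with hU
  have hUo : IsOpen U :=
    isOpen_ne.inter (isOpen_lt (by fun_prop) continuous_const)
  refine (hUo.measure_pos volume ⟨(2 * ‖ξ‖ ^ 2)⁻¹ • ξ, ?_, ?_⟩).trans_le (measure_mono ?_)
  · exact smul_ne_zero (by positivity) hξ
  · have : 2 * π * ⟪(2 * ‖ξ‖ ^ 2)⁻¹ • ξ, ξ⟫ = π := by
      rw [real_inner_smul_left, real_inner_self_eq_norm_sq]
      field_simp
    simp only [Set.mem_ofPred_eq, this, cos_pi]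
    norm_num
  · rintro z ⟨hz, hz'⟩
    have : 0 < ‖z‖ := norm_pos_iff.2 hz
    have h2 : 0 < 1 - cos (2 * π * ⟪z, ξ⟫) := sub_pos.2 hz'
    exact (div_pos h2 (by positivity)).ne'

lemma exists_halfLapSymbol_eq : ∃ c : ℝ, 0 < c ∧ ∀ ξ : E3, halfLapSymbol ξ = c * ‖ξ‖ := by
  set e : E3 := EuclideanSpace.single 0 1 with he
  have hne : ‖e‖ = 1 := by simp [he]
  refine ⟨halfLapSymbol e, halfLapSymbol_pos (norm_ne_zero_iff.1 (by simp [hne])), fun ξ => ?_⟩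
  rcases eq_or_ne ξ 0 with rfl | hξ
  · simp [halfLapSymbol]
  have hn : 0 < ‖ξ‖ := norm_pos_iff.2 hξ
  rw [halfLapSymbol_eq_of_norm_eq (ζ := ‖ξ‖ • e) (by simp [norm_smul, hne]),
    halfLapSymbol_smul hn, mul_comm]

/-- The kernel `‖z‖⁻⁴` truncated to `‖z‖ > ε`. -/
noncomputable def truncKernel (ε : ℝ) : E3 → ℝ :=
  Set.indicator {z : E3 | ε < ‖z‖} fun z => (‖z‖ ^ 4)⁻¹

lemma measurableSet_lt_norm (ε : ℝ) : MeasurableSet {z : E3 | ε < ‖z‖} :=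
  measurableSet_lt measurable_const measurable_norm

lemma measurable_truncKernel (ε : ℝ) : Measurable (truncKernel ε) :=
  Measurable.indicator (by fun_prop) (measurableSet_lt_norm ε)

lemma truncKernel_nonneg (ε : ℝ) (z : E3) : 0 ≤ truncKernel ε z :=
  Set.indicator_nonneg (fun _ _ => by positivity) z

lemma truncKernel_le (ε : ℝ) (z : E3) : truncKernel ε z ≤ (‖z‖ ^ 4)⁻¹ :=
  Set.indicator_le_self' (fun _ _ => by positivity) z

lemma truncKernel_neg (ε : ℝ) (z : E3) : truncKernel ε (-z) = truncKernel ε z := by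
  simp [truncKernel, Set.indicator_apply]

lemma integrable_truncKernel {ε : ℝ} (hε : 0 < ε) : Integrable (truncKernel ε) := by
  refine (integrable_inv_norm_sq_mul_one_add_norm_sq.const_mul (1 + (ε ^ 2)⁻¹)).mono'
    (measurable_truncKernel ε).aestronglyMeasurable (Eventually.of_forall fun z => ?_)
  rw [norm_of_nonneg (truncKernel_nonneg ε z)]
  by_cases hz : ε < ‖z‖
  · have hz0 : 0 < ‖z‖ := hε.trans hz
    have h1 : truncKernel ε z = (‖z‖ ^ 4)⁻¹ := Set.indicator_of_mem (by exact hz) _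
    have h2 : ε ^ 2 ≤ ‖z‖ ^ 2 := by gcongr
    have h3 : 1 ≤ (ε ^ 2)⁻¹ * ‖z‖ ^ 2 := by
      rw [← div_eq_inv_mul, one_le_div (by positivity)]; exact h2
    rw [h1, ← div_eq_mul_inv, inv_eq_one_div, div_le_div_iff₀ (by positivity) (by positivity)]
    nlinarith [mul_le_mul_of_nonneg_right h3 (sq_nonneg ‖z‖)]
  · have h1 : truncKernel ε z = 0 := Set.indicator_of_notMem (by exact hz) _
    rw [h1]; positivity

lemma tendsto_truncKernel (z : E3) :
    Tendsto (fun ε => truncKernel ε z) (nhdsWithin 0 (Set.Ioi 0)) (nhds (‖z‖ ^ 4)⁻¹) := by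
  rcases eq_or_ne z 0 with rfl | hz
  · refine tendsto_const_nhds.congr' ?_
    filter_upwards with ε
    simp [truncKernel, Set.indicator_apply]
  · refine tendsto_const_nhds.congr' ?_
    filter_upwards [nhdsWithin_le_nhds (Iio_mem_nhds (norm_pos_iff.2 hz))] with ε hε
    exact (Set.indicator_of_mem (show z ∈ {z : E3 | ε < ‖z‖} from hε)
      fun z : E3 => (‖z‖ ^ 4)⁻¹).symm

lemma integral_truncKernel_one_sub_exp {ε : ℝ} (hε : 0 < ε) (ξ : E3) :
    ∫ z : E3, (truncKernel ε z : ℂ) * (1 - Complex.exp (-(2 * π * ⟪z, ξ⟫ : ℝ) * Complex.I))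
      = (∫ z : E3, truncKernel ε z * (1 - cos (2 * π * ⟪z, ξ⟫)) : ℝ) := by
  have hK := integrable_truncKernel hε
  have hc : Integrable (fun z : E3 => truncKernel ε z * (1 - cos (2 * π * ⟪z, ξ⟫))) := by
    refine (hK.const_mul 2).mono' (hK.aestronglyMeasurable.mul
      (Continuous.aestronglyMeasurable (by fun_prop))) (Eventually.of_forall fun z => ?_)
    rw [norm_of_nonneg (mul_nonneg (truncKernel_nonneg ε z) (one_sub_cos_nonneg _)), mul_comm]
    exact mul_le_mul_of_nonneg_right (by linarith [neg_one_le_cos (2 * π * ⟪z, ξ⟫)])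
      (truncKernel_nonneg ε z)
  have hs : Integrable (fun z : E3 => truncKernel ε z * sin (2 * π * ⟪z, ξ⟫)) := by
    refine hK.mono' (hK.aestronglyMeasurable.mul
      (Continuous.aestronglyMeasurable (by fun_prop))) (Eventually.of_forall fun z => ?_)
    rw [norm_mul, norm_of_nonneg (truncKernel_nonneg ε z)]
    exact mul_le_of_le_one_right (truncKernel_nonneg ε z) (abs_sin_le_one _)
  have hs0 : ∫ z : E3, truncKernel ε z * sin (2 * π * ⟪z, ξ⟫) = 0 := by
    have h1 := integral_neg_eq_self (fun z : E3 => truncKernel ε z * sin (2 * π * ⟪z, ξ⟫)) volume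
    simp only [truncKernel_neg, inner_neg_left, mul_neg, sin_neg, integral_neg] at h1
    linarith
  have h : ∀ z : E3,
      (truncKernel ε z : ℂ) * (1 - Complex.exp (-(2 * π * ⟪z, ξ⟫ : ℝ) * Complex.I))
      = ((truncKernel ε z * (1 - cos (2 * π * ⟪z, ξ⟫)) : ℝ) : ℂ)
        + Complex.I * ((truncKernel ε z * sin (2 * π * ⟪z, ξ⟫) : ℝ) : ℂ) := by
    intro z
    rw [Complex.exp_mul_I, Complex.cos_neg, Complex.sin_neg, ← Complex.ofReal_cos,
      ← Complex.ofReal_sin]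
    push_cast
    ring
  simp_rw [h]
  rw [integral_add hc.ofReal (hs.ofReal.const_mul _), integral_const_mul, integral_complex_ofReal,
    integral_complex_ofReal, hs0]
  simp

lemma integral_truncKernel_one_sub_cos_le (ε : ℝ) (ξ : E3) :
    ∫ z : E3, truncKernel ε z * (1 - cos (2 * π * ⟪z, ξ⟫)) ≤ halfLapSymbol ξ := by
  refine integral_mono_of_nonneg (Eventually.of_forall fun z =>
    mul_nonneg (truncKernel_nonneg ε z) (one_sub_cos_nonneg _)) (integrable_one_sub_cos_div ξ)
    (Eventually.of_forall fun z => ?_)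
  dsimp only
  rw [div_eq_inv_mul]
  exact mul_le_mul_of_nonneg_right (truncKernel_le ε z) (one_sub_cos_nonneg _)

lemma tendsto_integral_truncKernel_one_sub_cos (ξ : E3) :
    Tendsto (fun ε => ∫ z : E3, truncKernel ε z * (1 - cos (2 * π * ⟪z, ξ⟫)))
      (nhdsWithin 0 (Set.Ioi 0)) (nhds (halfLapSymbol ξ)) := by
  refine tendsto_integral_filter_of_dominated_convergence _
    (Eventually.of_forall fun ε => ?_) (Eventually.of_forall fun ε => Eventually.of_forall
      fun z => ?_) (integrable_one_sub_cos_div ξ) (Eventually.of_forall fun z => ?_)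
  · exact (measurable_truncKernel ε).aestronglyMeasurable.mul
      (Continuous.aestronglyMeasurable (by fun_prop))
  · rw [norm_of_nonneg (mul_nonneg (truncKernel_nonneg ε z) (one_sub_cos_nonneg _)),
      div_eq_inv_mul]
    exact mul_le_mul_of_nonneg_right (truncKernel_le ε z) (one_sub_cos_nonneg _)
  · rw [div_eq_inv_mul]
    exact (tendsto_truncKernel z).mul_const _

open scoped FourierTransform in
lemma setIntegral_sub_div_eq_s9 {g : E3 → ℂ} (hg : Integrable g) {φ : E3 → ℝ}
    (hφ : ∀ x, φ x = (𝓕⁻ g x).re) {ε : ℝ} (hε : 0 < ε) (x : E3) :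
    ∫ y in {y : E3 | ε < ‖x - y‖}, (φ x - φ y) / ‖x - y‖ ^ 4
      = (∫ ξ : E3, Complex.exp ((2 * π * ⟪ξ, x⟫ : ℝ) * Complex.I) *
          ((∫ z : E3, truncKernel ε z * (1 - cos (2 * π * ⟪z, ξ⟫)) : ℝ) * g ξ)).re := by
  have hK := integrable_truncKernel hε
  have h1 : ∫ y in {y : E3 | ε < ‖x - y‖}, (φ x - φ y) / ‖x - y‖ ^ 4
      = ∫ z : E3, truncKernel ε z * (φ x - φ (x - z)) := by
    rw [← integral_sub_left_eq_self (fun z => truncKernel ε z * (φ x - φ (x - z))) volume x,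
      ← integral_indicator (measurableSet_lt (by fun_prop) (by fun_prop))]
    congr 1 with y
    simp only [Set.indicator_apply, truncKernel, sub_sub_cancel, Set.mem_ofPred_eq]
    split_ifs
    · rw [div_eq_inv_mul]
    · simp
  have hexp : ∀ y : E3, Integrable
      (fun ξ : E3 => Complex.exp ((2 * π * ⟪ξ, y⟫ : ℝ) * Complex.I) * g ξ) := by
    intro y
    refine hg.norm.mono' ((Continuous.aestronglyMeasurable (by fun_prop)).mul
      hg.aestronglyMeasurable) (Eventually.of_forall fun ξ => ?_)
    rw [norm_mul, Complex.norm_exp_ofReal_mul_I, one_mul]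
  set F : E3 → E3 → ℂ := fun z ξ => (truncKernel ε z : ℂ) *
    (1 - Complex.exp (-(2 * π * ⟪z, ξ⟫ : ℝ) * Complex.I)) *
      (Complex.exp ((2 * π * ⟪ξ, x⟫ : ℝ) * Complex.I) * g ξ) with hF
  have hF1 : ∀ z, ∫ ξ, F z ξ = truncKernel ε z * (𝓕⁻ g x - 𝓕⁻ g (x - z)) := by
    intro z
    rw [fourierInv_eq', fourierInv_eq']
    simp only [smul_eq_mul]
    rw [← integral_sub (hexp x) (hexp (x - z)), ← integral_const_mul]
    congr 1 with ξ
    have : Complex.exp ((2 * π * ⟪ξ, x - z⟫ : ℝ) * Complex.I)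
        = Complex.exp (-(2 * π * ⟪z, ξ⟫ : ℝ) * Complex.I)
          * Complex.exp ((2 * π * ⟪ξ, x⟫ : ℝ) * Complex.I) := by
      rw [← Complex.exp_add, inner_sub_right, real_inner_comm z ξ]
      congr 1
      push_cast
      ring
    rw [this, hF]
    ring
  have hFi : Integrable (Function.uncurry F) (volume.prod volume) := by
    refine ((hK.ofReal (𝕜 := ℂ)).mul_prod hg).norm.const_mul 2 |>.mono' ?_
      (Eventually.of_forall fun p => ?_)
    · have hm := ((hK.ofReal (𝕜 := ℂ)).mul_prod hg).aestronglyMeasurable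
      have hc : Continuous fun p : E3 × E3 =>
          (1 - Complex.exp (-(2 * π * ⟪p.1, p.2⟫ : ℝ) * Complex.I)) *
            Complex.exp ((2 * π * ⟪p.2, x⟫ : ℝ) * Complex.I) := by fun_prop
      refine (hm.mul hc.aestronglyMeasurable).congr (Eventually.of_forall fun p => ?_)
      simp only [Pi.mul_apply, Function.uncurry, hF, RCLike.ofReal_eq_complex_ofReal]
      ring
    · simp only [Function.uncurry, hF, norm_mul, Complex.norm_exp_ofReal_mul_I, one_mul]
      have h2 : ‖1 - Complex.exp (-(2 * π * ⟪p.1, p.2⟫ : ℝ) * Complex.I)‖ ≤ 2 := by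
        refine (norm_sub_le _ _).trans ?_
        rw [← Complex.ofReal_neg, Complex.norm_exp_ofReal_mul_I, norm_one]
        norm_num
      calc _ ≤ ‖(truncKernel ε p.1 : ℂ)‖ * 2 * ‖g p.2‖ := by gcongr
        _ = _ := by simp only [RCLike.ofReal_eq_complex_ofReal]; ring
  have h3 : ∀ z, truncKernel ε z * (φ x - φ (x - z)) = Complex.reCLM (∫ ξ, F z ξ) := by
    intro z
    rw [hF1, hφ, hφ, Complex.reCLM_apply, Complex.re_ofReal_mul, Complex.sub_re]
  rw [h1]
  simp_rw [h3]
  rw [Complex.reCLM.integral_comp_comm (φ := fun z => ∫ ξ, F z ξ) hFi.integral_prod_left, integral_integral_swap hFi,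
    Complex.reCLM_apply]
  congr 2 with ξ
  rw [hF]
  dsimp only
  rw [integral_mul_const, integral_truncKernel_one_sub_exp hε]
  ring

open scoped FourierTransform in
/-- The half Laplacian is the Fourier multiplier with symbol `halfLapSymbol / π ^ 2`. -/
lemma halfLap_eq_fourierInv {g : E3 → ℂ} (hg : Integrable g)
    (hg' : Integrable fun ξ => (halfLapSymbol ξ : ℂ) * g ξ) {φ : SchwartzMap E3 ℝ}
    (hφ : ∀ x, φ x = (𝓕⁻ g x).re) (x : E3) :
    halfLap φ x = 1 / π ^ 2 * (𝓕⁻ (fun ξ => (halfLapSymbol ξ : ℂ) * g ξ) x).re := by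
  refine Tendsto.limUnder_eq (Tendsto.const_mul _ ?_)
  have key : Tendsto (fun ε => ∫ ξ : E3, Complex.exp ((2 * π * ⟪ξ, x⟫ : ℝ) * Complex.I) *
      ((∫ z : E3, truncKernel ε z * (1 - cos (2 * π * ⟪z, ξ⟫)) : ℝ) * g ξ))
      (nhdsWithin 0 (Set.Ioi 0)) (nhds (𝓕⁻ (fun ξ => (halfLapSymbol ξ : ℂ) * g ξ) x)) := by
    rw [fourierInv_eq']
    refine tendsto_integral_filter_of_dominated_convergence _
      (Eventually.of_forall fun ε => ?_) (Eventually.of_forall fun ε => Eventually.of_forall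
      fun ξ => ?_) hg'.norm (Eventually.of_forall fun ξ => ?_)
    · refine (Continuous.aestronglyMeasurable (by fun_prop)).mul
        (AEStronglyMeasurable.mul ?_ hg.aestronglyMeasurable)
      refine Complex.continuous_ofReal.comp_aestronglyMeasurable ?_
      refine (StronglyMeasurable.integral_prod_right' (f := fun p : E3 × E3 =>
        truncKernel ε p.2 * (1 - cos (2 * π * ⟪p.2, p.1⟫))) ?_).aestronglyMeasurable
      have := measurable_truncKernel ε
      exact Measurable.stronglyMeasurable (by fun_prop)
    · rw [norm_mul, Complex.norm_exp_ofReal_mul_I, one_mul, norm_mul, norm_mul,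
        Complex.norm_real, Complex.norm_real, norm_of_nonneg (halfLapSymbol_nonneg ξ),
        norm_of_nonneg (integral_nonneg fun z =>
          mul_nonneg (truncKernel_nonneg ε z) (one_sub_cos_nonneg _))]
      exact mul_le_mul_of_nonneg_right (integral_truncKernel_one_sub_cos_le ε ξ) (norm_nonneg _)
    · exact ((Complex.continuous_ofReal.tendsto _).comp
        (tendsto_integral_truncKernel_one_sub_cos ξ)).mul_const _ |>.const_mul _
  refine ((Complex.continuous_re.tendsto _).comp key).congr' ?_
  filter_upwards [self_mem_nhdsWithin] with ε hε
  exact (setIntegral_sub_div_eq_s9 hg hφ hε x).symm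

/-- The `L¹`-normalized dilation `r⁻³ k(x / r)`. -/
noncomputable def dil (k : E3 → ℝ) (r : ℝ) (x : E3) : ℝ := (r ^ 3)⁻¹ * k (r⁻¹ • x)

open scoped FourierTransform in
lemma integral_exp_mul_comp_smul (X : E3 → ℂ) {r : ℝ} (hr : 0 < r) (x y : E3) :
    ∫ ξ : E3, Complex.exp ((2 * π * ⟪ξ, y - x⟫ : ℝ) * Complex.I) * X (r • ξ)
      = ((r ^ 3)⁻¹ : ℝ) * 𝓕⁻ X (r⁻¹ • (y - x)) := by
  have h := Measure.integral_comp_smul volume (fun ζ : E3 =>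
    Complex.exp ((2 * π * ⟪ζ, r⁻¹ • (y - x)⟫ : ℝ) * Complex.I) * X ζ) r
  rw [finrank_euclideanSpace, Fintype.card_fin, abs_of_pos (by positivity)] at h
  rw [fourierInv_eq']
  simp only [smul_eq_mul]
  rw [← Complex.real_smul, ← h]
  congr 1 with ξ
  rw [real_inner_smul_left, real_inner_smul_right, mul_inv_cancel_left₀ hr.ne']

lemma contDiff_bump_sub_div_norm (χ : ContDiffBump (0 : E3)) (r R : ℝ) (x : E3) :
    ContDiff ℝ (⊤ : ℕ∞) fun ξ : E3 =>
      Complex.exp (-(2 * π * ⟪ξ, x⟫ : ℝ) * Complex.I)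
        * (((χ (r • ξ) - χ (R • ξ)) * ‖ξ‖⁻¹ : ℝ) : ℂ) := by
  have hre : ContDiff ℝ (⊤ : ℕ∞) fun ξ : E3 => (χ (r • ξ) - χ (R • ξ)) * ‖ξ‖⁻¹ := by
    rw [contDiff_iff_contDiffAt]
    intro ξ
    by_cases hξ : ξ = 0
    · have h1 : ∀ s : ℝ, ∀ᶠ ζ : E3 in nhds ξ, χ (s • ζ) = 1 := by
        intro s
        have : Tendsto (fun ζ : E3 => s • ζ) (nhds ξ) (nhds 0) := by
          rw [hξ]
          exact Continuous.tendsto' (by fun_prop) _ _ (by simp)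
        exact this.eventually χ.eventuallyEq_one
      refine (contDiffAt_const (c := (0 : ℝ))).congr_of_eventuallyEq ?_
      filter_upwards [h1 r, h1 R] with ζ h2 h3
      rw [h2, h3, sub_self, zero_mul]
    · have hχ : ∀ s : ℝ, ContDiff ℝ (⊤ : ℕ∞) fun ζ : E3 => χ (s • ζ) := fun s =>
        χ.contDiff.comp (contDiff_const_smul s)
      exact ((hχ r).sub (hχ R)).contDiffAt.mul
        ((contDiffAt_norm ℝ hξ).inv (norm_ne_zero_iff.2 hξ))
  refine ContDiff.mul ?_ (Complex.ofRealCLM.contDiff.comp hre)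
  refine ContDiff.cexp (ContDiff.mul (ContDiff.neg (Complex.ofRealCLM.contDiff.comp ?_))
    contDiff_const)
  exact contDiff_const.mul (contDiff_id.inner ℝ contDiff_const)

open scoped FourierTransform in
/-- Band-limited kernels: differences of dilates and translates of a suitable Schwartz function of
integral one lie in the range of the half Laplacian. -/
lemma exists_kernel : ∃ k : SchwartzMap E3 ℝ, ∫ x, k x = 1 ∧
    ∀ r R : ℝ, 0 < r → 0 < R → ∀ x : E3, ∃ φ : SchwartzMap E3 ℝ,
      ∀ y, halfLap φ y = dil k r (y - x) - dil k R (y - x) := by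
  obtain ⟨c, hc, hsymb⟩ := exists_halfLapSymbol_eq
  set χ : ContDiffBump (0 : E3) := ⟨1, 2, one_pos, one_lt_two⟩
  have hXs : HasCompactSupport fun ξ : E3 => (χ ξ : ℂ) :=
    χ.hasCompactSupport.comp_left (g := ((↑) : ℝ → ℂ)) Complex.ofReal_zero
  set X : SchwartzMap E3 ℂ := hXs.toSchwartzMap (Complex.ofRealCLM.contDiff.comp χ.contDiff)
    with hX
  have hXc : ∀ ξ, X ξ = (χ ξ : ℂ) := fun ξ => rfl
  set k : SchwartzMap E3 ℝ := SchwartzMap.postcompCLM Complex.reCLM (𝓕⁻ X) with hk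
  have hkx : ∀ x, k x = (𝓕⁻ (X : E3 → ℂ) x).re := fun x => by
    rw [← SchwartzMap.fourierInv_coe]; rfl
  refine ⟨k, ?_, fun r R hr hR x => ?_⟩
  · have h1 : ∫ x, (𝓕⁻ X) x = 1 := by
      have h2 : (𝓕 (𝓕⁻ X)) 0 = X 0 := by rw [FourierTransform.fourier_fourierInv_eq]
      rw [SchwartzMap.fourier_coe, fourier_eq', hXc, χ.one_of_mem_closedBall (by simp [χ])] at h2
      simpa using h2
    have h3 := Complex.reCLM.integral_comp_comm (𝓕⁻ X).integrable (μ := volume)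
    rw [h1] at h3
    exact h3
  · have hχs : ∀ s : ℝ, 0 < s → HasCompactSupport fun ξ : E3 => χ (s • ξ) := fun s hs =>
      χ.hasCompactSupport.comp_smul hs.ne'
    set g0 : E3 → ℂ := fun ξ => Complex.exp (-(2 * π * ⟪ξ, x⟫ : ℝ) * Complex.I)
        * (((χ (r • ξ) - χ (R • ξ)) * ‖ξ‖⁻¹ : ℝ) : ℂ) with hg0
    have hg0s : HasCompactSupport g0 :=
      (((hχs r hr).sub (hχs R hR)).mul_right.comp_left (g := ((↑) : ℝ → ℂ))
        Complex.ofReal_zero).mul_left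
    set G : SchwartzMap E3 ℂ := (π ^ 2 / c : ℂ) •
      hg0s.toSchwartzMap (contDiff_bump_sub_div_norm χ r R x) with hG
    have hGx : ∀ ξ, (halfLapSymbol ξ : ℂ) * G ξ
        = (π ^ 2 : ℂ) * (Complex.exp (-(2 * π * ⟪ξ, x⟫ : ℝ) * Complex.I) * X (r • ξ))
          - (π ^ 2 : ℂ) * (Complex.exp (-(2 * π * ⟪ξ, x⟫ : ℝ) * Complex.I) * X (R • ξ)) := by
      intro ξ
      have : G ξ = (π ^ 2 / c : ℂ) * g0 ξ := rfl
      rw [this, hsymb, hXc, hXc, hg0]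
      rcases eq_or_ne ξ 0 with rfl | hξ
      · simp
      have hn : (‖ξ‖ : ℂ) ≠ 0 := Complex.ofReal_ne_zero.2 (norm_ne_zero_iff.2 hξ)
      have hc' : (c : ℂ) ≠ 0 := Complex.ofReal_ne_zero.2 hc.ne'
      push_cast
      field_simp
    have hi : ∀ y : E3, ∀ s : ℝ, 0 < s → Integrable fun ξ : E3 =>
        Complex.exp ((2 * π * ⟪ξ, y⟫ : ℝ) * Complex.I) * X (s • ξ) := by
      intro y s hs
      refine Continuous.integrable_of_hasCompactSupport ?_ ?_
      · have := X.continuous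
        fun_prop
      · exact (hXs.comp_smul hs.ne').mul_left
    refine ⟨SchwartzMap.postcompCLM Complex.reCLM (𝓕⁻ G), fun y => ?_⟩
    rw [halfLap_eq_fourierInv G.integrable ?_ (fun x => by
      rw [← SchwartzMap.fourierInv_coe]; rfl)]
    · have h4 : 𝓕⁻ (fun ξ => (halfLapSymbol ξ : ℂ) * G ξ) y
          = ((π ^ 2 : ℝ) : ℂ) * (((r ^ 3)⁻¹ : ℝ) * 𝓕⁻ (X : E3 → ℂ) (r⁻¹ • (y - x))
            - ((R ^ 3)⁻¹ : ℝ) * 𝓕⁻ (X : E3 → ℂ) (R⁻¹ • (y - x))) := by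
        rw [← integral_exp_mul_comp_smul _ hr, ← integral_exp_mul_comp_smul _ hR,
          ← integral_sub (hi _ r hr) (hi _ R hR), ← integral_const_mul, fourierInv_eq']
        congr 1 with ξ
        have h5 : Complex.exp ((2 * π * ⟪ξ, y - x⟫ : ℝ) * Complex.I)
            = Complex.exp ((2 * π * ⟪ξ, y⟫ : ℝ) * Complex.I)
              * Complex.exp (-(2 * π * ⟪ξ, x⟫ : ℝ) * Complex.I) := by
          rw [← Complex.exp_add, inner_sub_right]
          congr 1
          push_cast
          ring
        rw [hGx, h5, smul_eq_mul]
        push_cast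
        ring
      rw [h4, Complex.re_ofReal_mul, Complex.sub_re, Complex.re_ofReal_mul, Complex.re_ofReal_mul,
        ← hkx, ← hkx, dil, dil]
      field_simp
    · simp_rw [hGx]
      have h6 := fun s hs => (hi (-x) s hs).const_mul (π ^ 2 : ℂ)
      simp only [inner_neg_right, mul_neg, Complex.ofReal_neg] at h6
      exact (h6 r hr).sub (h6 R hR)

lemma SchwartzMap.exists_norm_le_mul_inv_one_add_norm_pow {F : Type*} [NormedAddCommGroup F]
    [NormedSpace ℝ F] (f : SchwartzMap E3 F) (n : ℕ) :
    ∃ C, 0 ≤ C ∧ ∀ x, ‖f x‖ ≤ C * ((1 + ‖x‖) ^ n)⁻¹ := by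
  have h := fun x => SchwartzMap.one_add_le_sup_seminorm_apply (𝕜 := ℝ) (m := (n, 0)) le_rfl le_rfl
    f x
  simp only [norm_iteratedFDeriv_zero] at h
  refine ⟨_, le_trans (by positivity) (h 0), fun x => ?_⟩
  rw [← div_eq_mul_inv, le_div_iff₀ (by positivity), mul_comm]
  exact h x

lemma SchwartzMap.integrable_one_add_norm_pow_four_mul (f : SchwartzMap E3 ℝ) :
    Integrable fun z => (1 + ‖z‖) ^ 4 * |f z| := by
  have := f.continuous
  refine (((f.integrable_pow_mul volume 0).add (f.integrable_pow_mul volume 4)).const_mul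
    8).mono' (Continuous.aestronglyMeasurable (by fun_prop)) (Eventually.of_forall fun z => ?_)
  rw [norm_of_nonneg (by positivity)]
  simp only [Pi.add_apply, norm_eq_abs]
  rw [← add_mul, ← mul_assoc]
  gcongr
  have := add_pow_le (zero_le_one (α := ℝ)) (norm_nonneg z) 4
  norm_num at this ⊢
  exact this

lemma inv_one_add_norm_sub_pow_le {E : Type*} [SeminormedAddCommGroup E] (x y : E) (n : ℕ) :
    ((1 + ‖x - y‖) ^ n)⁻¹ ≤ (1 + ‖y‖) ^ n * ((1 + ‖x‖) ^ n)⁻¹ := by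
  rw [← div_eq_mul_inv, inv_eq_one_div, div_le_div_iff₀ (by positivity) (by positivity), one_mul,
    ← mul_pow]
  gcongr
  have h : ‖x‖ ≤ ‖x - y‖ + ‖y‖ := by simpa using norm_add_le (x - y) y
  nlinarith [norm_nonneg (x - y), norm_nonneg y]

lemma MemL12.integrable_weight {w : E3 → ℝ} (hw : MemL12 w) :
    Integrable fun y => |w y| * ((1 + ‖y‖) ^ 4)⁻¹ := by
  refine hw.2.mono' (hw.1.aestronglyMeasurable.norm.mul
    (Measurable.aestronglyMeasurable (by fun_prop))) (Eventually.of_forall fun y => ?_)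
  rw [norm_of_nonneg (by positivity), ← div_eq_mul_inv]
  gcongr
  nlinarith [norm_nonneg y, pow_nonneg (norm_nonneg y) 2, pow_nonneg (norm_nonneg y) 3]

lemma MemL12.integrable_mul {w : E3 → ℝ} (hw : MemL12 w) {b : E3 → ℝ}
    (hb : AEStronglyMeasurable b) {C : ℝ} (hC : ∀ y, |b y| ≤ C * ((1 + ‖y‖) ^ 4)⁻¹) :
    Integrable fun y => w y * b y := by
  refine (hw.integrable_weight.const_mul C).mono' (hw.1.aestronglyMeasurable.mul hb)
    (Eventually.of_forall fun y => ?_)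
  rw [norm_mul, norm_eq_abs, norm_eq_abs]
  calc |w y| * |b y| ≤ |w y| * (C * ((1 + ‖y‖) ^ 4)⁻¹) := by gcongr; exact hC y
    _ = _ := by ring

lemma continuous_dil (k : SchwartzMap E3 ℝ) (r : ℝ) : Continuous (dil k r) := by
  have := k.continuous
  unfold dil
  fun_prop

lemma exists_abs_dil_le (k : SchwartzMap E3 ℝ) {r : ℝ} (hr : 0 < r) :
    ∃ C, 0 ≤ C ∧ ∀ x, |dil k r x| ≤ C * ((1 + ‖x‖) ^ 4)⁻¹ := by
  obtain ⟨C, hC, h⟩ := k.exists_norm_le_mul_inv_one_add_norm_pow 4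
  refine ⟨(r ^ 3)⁻¹ * (C * (1 + r) ^ 4), by positivity, fun x => ?_⟩
  rw [dil, abs_mul, abs_of_pos (by positivity), mul_assoc]
  gcongr
  refine (h _).trans ?_
  rw [mul_assoc]
  gcongr
  rw [← div_eq_mul_inv, inv_eq_one_div, div_le_div_iff₀ (by positivity) (by positivity), one_mul,
    ← mul_pow, norm_smul, norm_of_nonneg (by positivity)]
  gcongr
  have h1 : (1 + r) * (1 + r⁻¹ * ‖x‖) = 1 + ‖x‖ + r + r⁻¹ * ‖x‖ := by field_simp; ring
  rw [h1]
  have : 0 ≤ r⁻¹ * ‖x‖ := by positivity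
  linarith

lemma exists_abs_dil_sub_le (k : SchwartzMap E3 ℝ) :
    ∃ C, 0 ≤ C ∧ ∀ (x y : E3) (R : ℝ), 1 + ‖x‖ ≤ R →
      |dil k R (y - x) - dil k R y| ≤ C * ‖x‖ * ((1 + ‖y‖) ^ 4)⁻¹ := by
  obtain ⟨C, hC, h⟩ := (SchwartzMap.fderivCLM ℝ E3 ℝ k).exists_norm_le_mul_inv_one_add_norm_pow 4
  refine ⟨C, hC, fun x y R hR => ?_⟩
  have hR0 : 0 < R := by linarith [norm_nonneg x]
  have hder : ∀ z ∈ Metric.closedBall (R⁻¹ • y) (R⁻¹ * ‖x‖),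
      ‖fderiv ℝ k z‖ ≤ C * (R ^ 4 * ((1 + ‖y‖) ^ 4)⁻¹) := by
    intro z hz
    refine (h z).trans ?_
    gcongr
    rw [← div_eq_mul_inv, inv_eq_one_div, div_le_div_iff₀ (by positivity) (by positivity), one_mul,
      ← mul_pow]
    gcongr
    rw [mem_closedBall_iff_norm'] at hz
    have h1 : ‖R⁻¹ • y‖ ≤ R⁻¹ * ‖x‖ + ‖z‖ := by
      have := norm_add_le (R⁻¹ • y - z) z
      rw [sub_add_cancel] at this
      linarith
    rw [norm_smul, norm_of_nonneg (by positivity)] at h1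
    have h2 := mul_le_mul_of_nonneg_left h1 hR0.le
    rw [mul_add, mul_inv_cancel_left₀ hR0.ne', mul_inv_cancel_left₀ hR0.ne'] at h2
    linarith
  have hmv := (convex_closedBall (R⁻¹ • y) (R⁻¹ * ‖x‖)).norm_image_sub_le_of_norm_fderiv_le
    (fun z _ => k.differentiableAt) hder
    (Metric.mem_closedBall_self (by positivity) : R⁻¹ • y ∈ _)
    (y := R⁻¹ • (y - x)) (by
      rw [mem_closedBall_iff_norm, ← smul_sub, sub_sub_cancel_left, norm_smul, norm_neg,
        norm_of_nonneg (by positivity)])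
  rw [← smul_sub, sub_sub_cancel_left, norm_smul, norm_neg,
    norm_of_nonneg (inv_nonneg.2 hR0.le), norm_eq_abs] at hmv
  rw [dil, dil, ← mul_sub, abs_mul, abs_of_pos (by positivity)]
  calc _ ≤ (R ^ 3)⁻¹ * (C * (R ^ 4 * ((1 + ‖y‖) ^ 4)⁻¹) * (R⁻¹ * ‖x‖)) := by gcongr
    _ = _ := by field_simp

lemma tendsto_dil_atTop (k : SchwartzMap E3 ℝ) (x : E3) :
    Tendsto (fun R => dil k R x) atTop (nhds 0) := by
  obtain ⟨C, hC, h⟩ := k.exists_norm_le_mul_inv_one_add_norm_pow 0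
  have h1 : Tendsto (fun R : ℝ => (R ^ 3)⁻¹) atTop (nhds 0) :=
    (tendsto_pow_atTop (by norm_num)).inv_tendsto_atTop
  refine h1.zero_mul_isBoundedUnder_le ⟨C, eventually_map.2 (Eventually.of_forall fun R => ?_)⟩
  simpa using h (R⁻¹ • x)

/-- The averages of `w ∈ L_{1/2}` against the dilated kernels become translation invariant at
large scales. -/
lemma MemL12.tendsto_integral_dil_sub {w : E3 → ℝ} (hw : MemL12 w) (k : SchwartzMap E3 ℝ)
    (x : E3) : Tendsto (fun R => ∫ y, w y * (dil k R (y - x) - dil k R y)) atTop (nhds 0) := by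
  obtain ⟨C, -, h⟩ := exists_abs_dil_sub_le k
  rw [← integral_zero E3 ℝ (μ := volume)]
  refine tendsto_integral_filter_of_dominated_convergence
    (fun y => C * ‖x‖ * (|w y| * ((1 + ‖y‖) ^ 4)⁻¹)) (Eventually.of_forall fun R => ?_)
    ?_ (hw.integrable_weight.const_mul _) (Eventually.of_forall fun y => ?_)
  · have := continuous_dil k R
    exact hw.1.aestronglyMeasurable.mul (Continuous.aestronglyMeasurable (by fun_prop))
  · filter_upwards [eventually_ge_atTop (1 + ‖x‖)] with R hR
    refine Eventually.of_forall fun y => ?_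
    rw [norm_mul, norm_eq_abs, norm_eq_abs]
    calc |w y| * _ ≤ |w y| * (C * ‖x‖ * ((1 + ‖y‖) ^ 4)⁻¹) := by gcongr; exact h x y R hR
      _ = _ := by ring
  · simpa using ((tendsto_dil_atTop k (y - x)).sub (tendsto_dil_atTop k y)).const_mul (w y)

lemma integral_mul_dil_sub (η k : E3 → ℝ) {r : ℝ} (hr : 0 < r) (y : E3) :
    ∫ x, η x * dil k r (y - x) = ∫ z, η (y - r • z) * k z := by
  have h := Measure.integral_comp_smul volume (fun u : E3 => η (y - u) * k (r⁻¹ • u)) r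
  rw [finrank_euclideanSpace, Fintype.card_fin, abs_of_pos (by positivity)] at h
  simp only [inv_smul_smul₀ hr.ne'] at h
  rw [h, ← integral_sub_left_eq_self (fun x => η x * dil k r (y - x)) volume y, smul_eq_mul,
    ← integral_const_mul]
  congr 1 with u
  rw [dil, sub_sub_cancel]
  ring

/-- The dilates of a Schwartz function of integral one form an approximate identity in duality
with `L_{1/2}`. -/
lemma MemL12.tendsto_integral_mul_integral_comp_smul {w : E3 → ℝ} (hw : MemL12 w)
    (η k : SchwartzMap E3 ℝ) (hk : ∫ x, k x = 1) :
    Tendsto (fun r : ℝ => ∫ y, w y * ∫ z, η (y - r • z) * k z)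
      (nhdsWithin 0 (Set.Ioi 0)) (nhds (∫ y, w y * η y)) := by
  have hηc := η.continuous
  have hkc := k.continuous
  obtain ⟨C, hC, h⟩ := η.exists_norm_le_mul_inv_one_add_norm_pow 4
  obtain ⟨C₀, hC₀, h₀⟩ := η.exists_norm_le_mul_inv_one_add_norm_pow 0
  have hki := k.integrable_one_add_norm_pow_four_mul
  refine tendsto_integral_filter_of_dominated_convergence
    (fun y => C * (∫ z, (1 + ‖z‖) ^ 4 * |k z|) * (|w y| * ((1 + ‖y‖) ^ 4)⁻¹))
    (Eventually.of_forall fun r => ?_) ?_ (hw.integrable_weight.const_mul _)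
    (Eventually.of_forall fun y => ?_)
  · refine hw.1.aestronglyMeasurable.mul (StronglyMeasurable.integral_prod_right'
      (f := fun p : E3 × E3 => η (p.1 - r • p.2) * k p.2) ?_).aestronglyMeasurable
    exact Continuous.stronglyMeasurable (by fun_prop)
  · filter_upwards [self_mem_nhdsWithin, nhdsWithin_le_nhds (Iio_mem_nhds one_pos)] with r hr hr1
    refine Eventually.of_forall fun y => ?_
    rw [norm_mul, norm_eq_abs]
    have hb : ‖∫ z, η (y - r • z) * k z‖
        ≤ ∫ z, C * ((1 + ‖y‖) ^ 4)⁻¹ * ((1 + ‖z‖) ^ 4 * |k z|) := by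
      refine norm_integral_le_of_norm_le (hki.const_mul _) (Eventually.of_forall fun z => ?_)
      rw [norm_mul, norm_eq_abs (k z)]
      have h1 : ‖r • z‖ ≤ ‖z‖ := by
        rw [norm_smul, norm_of_nonneg (Set.mem_Ioi.1 hr).le]
        exact mul_le_of_le_one_left (norm_nonneg z) (Set.mem_Iio.1 hr1).le
      calc ‖η (y - r • z)‖ * |k z|
          ≤ C * ((1 + ‖r • z‖) ^ 4 * ((1 + ‖y‖) ^ 4)⁻¹) * |k z| := by
            gcongr
            refine (h _).trans ?_
            gcongr
            exact inv_one_add_norm_sub_pow_le _ _ _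
        _ ≤ C * ((1 + ‖z‖) ^ 4 * ((1 + ‖y‖) ^ 4)⁻¹) * |k z| := by gcongr
        _ = _ := by ring
    rw [integral_const_mul] at hb
    calc |w y| * _ ≤ |w y| * _ := mul_le_mul_of_nonneg_left hb (abs_nonneg _)
      _ = _ := by ring
  · refine Tendsto.const_mul _ ?_
    have h2 : ∫ z, η y * k z = η y := by rw [integral_const_mul, hk, mul_one]
    suffices Tendsto (fun r : ℝ => ∫ z, η (y - r • z) * k z) (nhdsWithin 0 (Set.Ioi 0))
        (nhds (∫ z, η y * k z)) by rwa [h2] at this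
    refine tendsto_integral_filter_of_dominated_convergence (fun z => C₀ * ‖k z‖)
      (Eventually.of_forall fun r => Continuous.aestronglyMeasurable (by fun_prop))
      (Eventually.of_forall fun r => Eventually.of_forall fun z => ?_)
      (k.integrable.norm.const_mul _) (Eventually.of_forall fun z => ?_)
    · rw [norm_mul]
      gcongr
      simpa using h₀ (y - r • z)
    · refine Tendsto.mul_const _ (tendsto_nhdsWithin_of_tendsto_nhds ?_)
      exact Continuous.tendsto' (by fun_prop) _ _ (by simp)

lemma MemL12.integral_mul_integral_dil {w : E3 → ℝ} (hw : MemL12 w) (η k : SchwartzMap E3 ℝ)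
    {r : ℝ} (hr : 0 < r) :
    ∫ x, η x * ∫ y, w y * dil k r (y - x) = ∫ y, w y * ∫ z, η (y - r • z) * k z := by
  obtain ⟨C, hC, h⟩ := exists_abs_dil_le k hr
  have hηi := η.integrable_one_add_norm_pow_four_mul
  have hi : Integrable (Function.uncurry fun x y => η x * (w y * dil k r (y - x)))
      (volume.prod volume) := by
    refine ((hηi.mul_prod hw.integrable_weight).const_mul C).mono' ?_
      (Eventually.of_forall fun p => ?_)
    · have := continuous_dil k r
      have := η.continuous
      exact (Continuous.aestronglyMeasurable (by fun_prop)).mul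
        (hw.1.aestronglyMeasurable.comp_snd.mul (Continuous.aestronglyMeasurable (by fun_prop)))
    · simp only [Function.uncurry, norm_mul, norm_eq_abs]
      calc _ ≤ |η p.1| * (|w p.2| * (C * ((1 + ‖p.1‖) ^ 4 * ((1 + ‖p.2‖) ^ 4)⁻¹))) := by
            gcongr
            refine (h _).trans ?_
            gcongr
            exact inv_one_add_norm_sub_pow_le _ _ _
        _ = _ := by ring
  simp_rw [← integral_const_mul]
  rw [integral_integral_swap hi]
  congr 1 with y
  rw [integral_const_mul, ← integral_mul_dil_sub _ _ hr, ← integral_const_mul]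
  congr 1 with x
  ring

/-- Theorem 9 (Liouville-type theorem): if `w ∈ L_{1/2}(ℝ³)` satisfies `(−Δ)^{1/2}w = 0`
in ℝ³ in the sense of tempered distributions, then `w` is a.e. equal to a constant. -/
theorem halfLaplacian_liouville (w : E3 → ℝ) (hw : MemL12 w)
    (h : ∀ φ : SchwartzMap E3 ℝ, ∫ x, w x * halfLap φ x = 0) :
    ∃ c : ℝ, w =ᵐ[volume] fun _ => c := by
  obtain ⟨k, hk, hker⟩ := exists_kernel
  have hint : ∀ (r : ℝ) (x : E3), 0 < r → Integrable fun y => w y * dil k r (y - x) := by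
    intro r x hr
    obtain ⟨C, hC, hb⟩ := exists_abs_dil_le k hr
    have := continuous_dil k r
    refine hw.integrable_mul (Continuous.aestronglyMeasurable (by fun_prop))
      (C := C * (1 + ‖x‖) ^ 4) fun y => (hb _).trans ?_
    rw [mul_assoc]
    gcongr
    exact inv_one_add_norm_sub_pow_le _ _ _
  have hscale : ∀ (r R : ℝ) (x : E3), 0 < r → 0 < R →
      ∫ y, w y * dil k r (y - x) = ∫ y, w y * dil k R (y - x) := by
    intro r R x hr hR
    obtain ⟨φ, hφ⟩ := hker r R hr hR x
    have h1 := h φ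
    simp_rw [hφ, mul_sub] at h1
    rw [integral_sub (hint r x hr) (hint R x hR)] at h1
    linarith
  set c := ∫ y, w y * dil k 1 (y - 0) with hc
  have hconst : ∀ (r : ℝ) (x : E3), 0 < r → ∫ y, w y * dil k r (y - x) = c := by
    intro r x hr
    have h1 := hw.tendsto_integral_dil_sub k x
    have h2 : (fun R => ∫ y, w y * (dil k R (y - x) - dil k R y)) =ᶠ[atTop]
        fun _ => (∫ y, w y * dil k r (y - x)) - c := by
      filter_upwards [eventually_gt_atTop 0] with R hR
      have h3 := hint R 0 hR
      simp only [sub_zero] at h3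
      simp_rw [mul_sub]
      rw [integral_sub (hint R x hR) h3, hscale r R x hr hR, hc, hscale 1 R 0 one_pos hR]
      simp only [sub_zero]
    exact sub_eq_zero.1 (tendsto_nhds_unique (tendsto_const_nhds.congr' h2.symm) h1)
  refine ⟨c, ?_⟩
  have hloc : LocallyIntegrable (fun x => w x - c) volume :=
    hw.1.sub (locallyIntegrable_const c)
  refine (ae_eq_zero_of_integral_contDiff_smul_eq_zero hloc fun g hg hgs => ?_).mono
    fun x hx => sub_eq_zero.1 hx
  set η : SchwartzMap E3 ℝ := hgs.toSchwartzMap hg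
  have hlim := hw.tendsto_integral_mul_integral_comp_smul η k hk
  have h4 : (fun r : ℝ => ∫ y, w y * ∫ z, η (y - r • z) * k z) =ᶠ[nhdsWithin 0 (Set.Ioi 0)]
      fun _ => ∫ x, η x * c := by
    filter_upwards [self_mem_nhdsWithin] with r hr
    rw [← hw.integral_mul_integral_dil η k hr]
    simp_rw [hconst r _ hr]
  have h5 : ∫ x, η x * c = ∫ y, w y * η y :=
    tendsto_nhds_unique (tendsto_const_nhds.congr' h4.symm) hlim
  obtain ⟨C, -, hb⟩ := η.exists_norm_le_mul_inv_one_add_norm_pow 4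
  have h6 : ∀ x, g x • (w x - c) = w x * η x - η x * c := fun x => by
    change g x * (w x - c) = w x * g x - g x * c
    ring
  simp_rw [h6]
  rw [integral_sub (hw.integrable_mul η.continuous.aestronglyMeasurable hb)
    (η.integrable.mul_const c), h5, sub_self]
end
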